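/- arXiv:2405.04747 — 11 statements merged into one kernel-verified Lean document; each statement's English description precedes it below -/
import Mathlib

section
/- Let t > s ≥ 0 be integers. Then the ideal quotient satisfies I_{n,m}^t : (f_{n+1}^s) = I_{n,m}^{t-s}. -/
open MvPolynomial

noncomputable def pexp (N m i : ℕ) : Fin N →₀ ℕ :=
  Finsupp.equivFunOnFinite.symm (fun v => if i ≤ v.val ∧ v.val < i + m then 1 else 0)

lemma pexp_apply (N m i : ℕ) (v : Fin N) :
    pexp N m i v = if i ≤ v.val ∧ v.val < i + m then 1 else 0 := rfl

def pset (N m n t : ℕ) : Set (Fin N →₀ ℕ) :=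
  {d | ∃ μ : Multiset ℕ, Multiset.card μ = t ∧ (∀ i ∈ μ, i ≤ n) ∧ (μ.map (pexp N m)).sum = d}

lemma sum_zero (N m : ℕ) (v : Fin N) (μ : Multiset ℕ) (h : ∀ i ∈ μ, pexp N m i v = 0) :
    (μ.map (pexp N m)).sum v = 0 := by
  induction μ using Multiset.induction with
  | empty => simp
  | cons a μ ih =>
    simp only [Multiset.map_cons, Multiset.sum_cons, Finsupp.add_apply]
    rw [h a (by simp), ih (fun i hi => h i (by simp [hi]))]

lemma key (m n t : ℕ) (a d : Fin (n + m) →₀ ℕ) (hd : d ∈ pset (n+m) m n (t+1))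
    (h : d ≤ a + pexp (n+m) m n) : ∃ d' ∈ pset (n+m) m n t, d' ≤ a := by
  obtain ⟨μ, hc, hn, rfl⟩ := hd
  have hne : μ.toFinset.Nonempty := by
    rw [Multiset.toFinset_nonempty]
    rintro rfl
    simp at hc
  obtain ⟨i, hi, hmax⟩ := μ.toFinset.exists_max_image id hne
  rw [Multiset.mem_toFinset] at hi
  obtain ⟨ν, rfl⟩ := Multiset.exists_cons_of_mem hi
  refine ⟨_, ⟨ν, by simpa using hc, fun j hj => hn j (by simp [hj]), rfl⟩, ?_⟩
  intro v
  have hv := h v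
  simp only [Multiset.map_cons, Multiset.sum_cons, Finsupp.add_apply] at hv
  have hin := hn i (by simp)
  by_cases hc1 : i + m ≤ v.val
  · rw [sum_zero]
    · exact Nat.zero_le _
    · intro j hj
      have : j ≤ i := hmax j (by simp [hj])
      rw [pexp_apply, if_neg (by omega)]
  · have : pexp (n+m) m n v ≤ pexp (n+m) m i v := by
      rw [pexp_apply, pexp_apply]
      split_ifs <;> omega
    omega

lemma pow_eq (k : Type*) [Field k] (N m n t : ℕ) :
    (Ideal.span ((fun i => monomial (pexp N m i) (1:k)) '' Set.Iic n)) ^ t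
      = Ideal.span ((fun d => monomial d (1:k)) '' pset N m n t) := by
  induction t with
  | zero =>
    rw [pow_zero, Ideal.one_eq_top, eq_comm, Ideal.eq_top_iff_one]
    exact Ideal.subset_span ⟨0, ⟨0, by simp⟩, by simp⟩
  | succ t ih =>
    rw [pow_succ, ih, Ideal.span_mul_span']
    congr 1
    ext x
    simp only [Set.mem_mul, Set.mem_image]
    constructor
    · rintro ⟨_, ⟨_, ⟨μ, h1, h2, rfl⟩, rfl⟩, _, ⟨i, hi, rfl⟩, rfl⟩
      refine ⟨_, ⟨i ::ₘ μ, by simp [h1], ?_, rfl⟩, ?_⟩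
      · intro j hj
        rcases Multiset.mem_cons.1 hj with rfl | hj
        · exact hi
        · exact h2 j hj
      · simp [monomial_mul, add_comm]
    · rintro ⟨_, ⟨μ, h1, h2, rfl⟩, rfl⟩
      obtain ⟨i, hi⟩ := Multiset.card_pos_iff_exists_mem.1 (show 0 < Multiset.card μ by omega)
      obtain ⟨ν, rfl⟩ := Multiset.exists_cons_of_mem hi
      have hν : Multiset.card ν = t := by simpa using h1
      refine ⟨_, ⟨_, ⟨ν, hν, fun j hj => h2 j (by simp [hj]), rfl⟩, rfl⟩, _,
        ⟨i, h2 i (by simp), rfl⟩, ?_⟩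
      simp [monomial_mul, add_comm]

theorem stmt_0 (k : Type*) [Field k] (m n : ℕ) (hm : 2 ≤ m)
    (f : ℕ → MvPolynomial (Fin (n + m)) k)
    (hf : ∀ i, ∀ hi : i ≤ n, f i = ∏ j : Fin m,
      X (⟨i + j.val, by have := j.isLt; omega⟩ : Fin (n + m)))
    (I : Ideal (MvPolynomial (Fin (n + m)) k))
    (hI : I = Ideal.span (f '' Set.Iic n))
    (t s : ℕ) (hst : s < t) :
    Submodule.colon (I ^ t) (Ideal.span {f n ^ s}) = I ^ (t - s) := by
  have hf' : ∀ i ≤ n, f i = monomial (pexp (n+m) m i) (1:k) := by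
    intro i hi
    rw [hf i hi]
    simp only [X]
    rw [← monomial_sum_one]
    congr 2
    ext v
    rw [Finsupp.finsetSum_apply, pexp_apply]
    simp only [Finsupp.single_apply, Fin.ext_iff]
    split_ifs with h
    · rw [Finset.sum_eq_single (⟨v.val - i, by omega⟩ : Fin m)]
      · rw [if_pos]
        simp; omega
      · intro b _ hb
        rw [if_neg]
        intro h'
        apply hb
        ext
        simp; omega
      · simp
    · apply Finset.sum_eq_zero
      intro j _
      rw [if_neg]
      have := j.isLt
      omega
  have hI' : I = Ideal.span ((fun i => monomial (pexp (n+m) m i) (1:k)) '' Set.Iic n) := by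
    rw [hI]
    congr 1
    exact Set.image_congr (fun i hi => hf' i hi)
  have hfI : f n ∈ I := by
    rw [hI]
    exact Ideal.subset_span ⟨n, by simp, rfl⟩
  have step : ∀ t x, x * f n ∈ I ^ (t+1) → x ∈ I ^ t := by
    intro t x hx
    rw [hI', pow_eq, mem_ideal_span_monomial_image] at hx ⊢
    intro a ha
    obtain ⟨d, hd, hle⟩ := hx (a + pexp (n+m) m n) (by
      rw [mem_support_iff, hf' n le_rfl, coeff_mul_monomial, mul_one]
      exact mem_support_iff.1 ha)
    exact key m n t a d hd hle
  have steps : ∀ s u x, x * f n ^ s ∈ I ^ (u + s) → x ∈ I ^ u := by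
    intro s
    induction s with
    | zero => intro u x hx; simpa using hx
    | succ s ih =>
      intro u x hx
      apply ih
      apply step
      rw [mul_assoc, ← pow_succ]
      exact hx
  obtain ⟨u, rfl⟩ : ∃ u, t = u + s := ⟨t - s, by omega⟩
  rw [Nat.add_sub_cancel]
  ext x
  rw [Submodule.mem_colon]
  constructor
  · intro h
    exact steps s u x (h _ (Ideal.subset_span rfl))
  · intro hx p hp
    obtain ⟨c, rfl⟩ := Ideal.mem_span_singleton.1 hp
    rw [smul_eq_mul, ← mul_assoc, pow_add]
    exact Ideal.mul_mem_right _ _ (Ideal.mul_mem_mul hx (Ideal.pow_mem_pow hfI s))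
end

section
/- Assume n ≥ m and let t ≥ s ≥ 1 be integers. Then J^t : (f_{n+1}^s) = A^{t-s+1}(A + (x_n))^{s-1} + x_n^s J^{t-s}. -/
open MvPolynomial

noncomputable def eexp (N m i : ℕ) : Fin N →₀ ℕ :=
  Finsupp.equivFunOnFinite.symm (fun v => if i ≤ v.val ∧ v.val < i + m then 1 else 0)

theorem eexp_apply (N m i : ℕ) (v : Fin N) :
    eexp N m i v = if i ≤ v.val ∧ v.val < i + m then 1 else 0 := rfl

theorem eexp_eq_sum (n m i : ℕ) (hi : i ≤ n) :
    eexp (n + m) m i = ∑ j : Fin m,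
      Finsupp.single (⟨i + j.val, by have := j.isLt; omega⟩ : Fin (n + m)) 1 := by
  ext v
  rw [eexp_apply, Finsupp.finsetSum_apply]
  simp only [Finsupp.single_apply, Fin.ext_iff]
  split_ifs with h
  · rw [Finset.sum_eq_single (⟨v.val - i, by omega⟩ : Fin m)]
    · rw [if_pos]; simp only []; omega
    · intro b _ hb
      rw [if_neg]
      intro h2
      apply hb
      ext
      simp only []
      omega
    · simp
  · symm
    apply Finset.sum_eq_zero
    intro j _
    rw [if_neg]
    have := j.isLt
    omega

theorem sum_eexp_apply (N m : ℕ) (l : List ℕ) (v : Fin N) :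
    (l.map (eexp N m)).sum v = l.countP (fun i => decide (i ≤ v.val ∧ v.val < i + m)) := by
  induction l with
  | nil => simp
  | cons a l ih =>
    rw [List.map_cons, List.sum_cons, Finsupp.add_apply, ih, eexp_apply, List.countP_cons]
    simp only [decide_eq_true_eq]
    omega

theorem mon_list_mem {k : Type*} [Field k] {N m : ℕ} (I : Ideal (MvPolynomial (Fin N) k))
    (l : List ℕ) (h : ∀ i ∈ l, monomial (eexp N m i) (1 : k) ∈ I) :
    monomial (l.map (eexp N m)).sum (1 : k) ∈ I ^ l.length := by
  induction l with
  | nil => simp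
  | cons a l ih =>
    rw [List.map_cons, List.sum_cons, List.length_cons, pow_succ', ← one_mul (1 : k),
      ← monomial_mul]
    exact Ideal.mul_mem_mul (h a (by simp)) (ih (fun i hi => h i (by simp [hi])))

theorem pow_le_span {k : Type*} [Field k] {N m n : ℕ} (f : ℕ → MvPolynomial (Fin N) k)
    (hf : ∀ i, i < n → f i = monomial (eexp N m i) 1) (t : ℕ) :
    Ideal.span (f '' Set.Iio n) ^ t ≤ Ideal.span ((fun d => monomial d (1 : k)) ''
      {d | ∃ l : List ℕ, l.length = t ∧ (∀ i ∈ l, i < n) ∧ d = (l.map (eexp N m)).sum}) := by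
  induction t with
  | zero =>
    rw [pow_zero, Ideal.one_eq_top, top_le_iff, Ideal.eq_top_iff_one]
    apply Ideal.subset_span
    exact ⟨0, ⟨[], by simp⟩, rfl⟩
  | succ t ih =>
    rw [pow_succ']
    refine (Ideal.mul_mono_right ih).trans ?_
    rw [Ideal.span_mul_span', Ideal.span_le]
    rintro _ ⟨_, ⟨i, hi, rfl⟩, _, ⟨_, ⟨l, hl, hl', rfl⟩, rfl⟩, rfl⟩
    apply Ideal.subset_span
    refine ⟨_, ⟨i :: l, by simp [hl], ?_, rfl⟩, ?_⟩
    · intro j hj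
      rcases List.mem_cons.1 hj with rfl | hj
      · exact hi
      · exact hl' j hj
    · simp [hf i hi, monomial_mul]

theorem count_drop (l : List ℕ) (hl : l.Pairwise (· ≥ ·)) (c s : ℕ) :
    (l.drop s).countP (fun i => decide (c ≤ i)) = l.countP (fun i => decide (c ≤ i)) - s := by
  induction l generalizing s with
  | nil => simp
  | cons a l ih =>
    rw [List.pairwise_cons] at hl
    cases s with
    | zero => simp
    | succ s =>
      rw [List.drop_succ_cons, ih hl.2, List.countP_cons]
      split_ifs with h
      · omega
      · have : l.countP (fun i => decide (c ≤ i)) = 0 := by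
          rw [List.countP_eq_zero]
          intro b hb
          have := hl.1 b hb
          simp at h ⊢
          omega
        omega

theorem mon_mem_of_le {k : Type*} [Field k] {σ : Type*} (I : Ideal (MvPolynomial σ k))
    {d e : σ →₀ ℕ} (h : d ≤ e) (hd : monomial d (1 : k) ∈ I) : monomial e (1 : k) ∈ I := by
  have : monomial e (1 : k) = monomial (e - d) 1 * monomial d 1 := by
    rw [monomial_mul, one_mul, tsub_add_cancel_of_le h]
  rw [this]
  exact Ideal.mul_mem_left _ _ hd

/-- Assume `n ≥ m` and let `t ≥ s ≥ 1` be integers. Then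
`J^t : (f_{n+1}^s) = A^{t-s+1}(A + (x_n))^{s-1} + x_n^s J^{t-s}`,
where `J = (f_1, …, f_n)`, `A = (f_1, …, f_{n-m})` and `f_i = x_i ⋯ x_{i+m-1}`.
Generators are 0-indexed: `f i` for `0 ≤ i ≤ n` is the paper's `f_{i+1}`,
so `f n` is the paper's `f_{n+1}`; the variable `x_n` is `X ⟨n-1, _⟩`. -/
theorem stmt_1 (k : Type*) [Field k] (m n : ℕ) (hm : 2 ≤ m) (hnm : m ≤ n)
    (f : ℕ → MvPolynomial (Fin (n + m)) k)
    (hf : ∀ i, ∀ hi : i ≤ n, f i = ∏ j : Fin m,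
      X (⟨i + j.val, by have := j.isLt; omega⟩ : Fin (n + m)))
    (J A : Ideal (MvPolynomial (Fin (n + m)) k))
    (hJ : J = Ideal.span (f '' Set.Iio n))
    (hA : A = Ideal.span (f '' Set.Iio (n - m)))
    (xn : MvPolynomial (Fin (n + m)) k)
    (hxn : xn = X (⟨n - 1, by omega⟩ : Fin (n + m)))
    (t s : ℕ) (hs : 1 ≤ s) (hst : s ≤ t) :
    Submodule.colon (J ^ t) (Ideal.span {f n ^ s}) =
      A ^ (t - s + 1) * (A + Ideal.span {xn}) ^ (s - 1)
        + Ideal.span {xn ^ s} * J ^ (t - s) := by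
  have hfe : ∀ i, i ≤ n → f i = monomial (eexp (n + m) m i) 1 := by
    intro i hi
    rw [hf i hi, eexp_eq_sum n m i hi, monomial_sum_one]
    rfl
  have hxpow : ∀ b, xn ^ b = monomial (Finsupp.single (⟨n - 1, by omega⟩ : Fin (n + m)) b) 1 := by
    intro b
    rw [hxn, X_pow_eq_monomial]
  have hfJ : ∀ i, i < n → monomial (eexp (n + m) m i) (1 : k) ∈ J := by
    intro i hi
    rw [hJ, ← hfe i hi.le]
    exact Ideal.subset_span ⟨i, hi, rfl⟩
  have hfA : ∀ i, i < n - m → monomial (eexp (n + m) m i) (1 : k) ∈ A := by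
    intro i hi
    rw [hA, ← hfe i (by omega)]
    exact Ideal.subset_span ⟨i, hi, rfl⟩
  have hAJ : A ≤ J := by
    rw [hA, hJ]
    apply Ideal.span_mono
    apply Set.image_mono
    intro i hi
    simp only [Set.mem_Iio] at hi ⊢
    omega
  have hxf : xn * f n ∈ J := by
    have h1 := hxpow 1
    rw [pow_one] at h1
    rw [h1, hfe n le_rfl, monomial_mul, one_mul]
    refine mon_mem_of_le J ?_ (hfJ (n - 1) (by omega))
    intro v
    rw [Finsupp.add_apply, eexp_apply, eexp_apply, Finsupp.single_apply]
    simp only [Fin.ext_iff]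
    split_ifs <;> omega
  have hxfs : ∀ r, Ideal.span {xn ^ r} * Ideal.span {f n ^ r} ≤ J ^ r := by
    intro r
    rw [Ideal.span_singleton_mul_span_singleton, ← mul_pow, Ideal.span_singleton_le_iff_mem]
    exact Ideal.pow_mem_pow hxf r
  apply le_antisymm
  · intro p hp
    have hp' : p * f n ^ s ∈ J ^ t := by
      rw [Submodule.mem_colon] at hp
      exact hp _ (Ideal.subset_span rfl)
    rw [hfe n le_rfl, monomial_pow, one_pow] at hp'
    rw [hJ] at hp'
    have hp2 := pow_le_span (m := m) f (fun i hi => hfe i hi.le) t hp'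
    rw [mem_ideal_span_monomial_image] at hp2
    rw [p.as_sum]
    apply Ideal.sum_mem
    intro d hd
    have hd' : d + s • eexp (n + m) m n ∈
        (p * monomial (s • eexp (n + m) m n) (1 : k)).support := by
      rw [mem_support_iff, coeff_mul_monomial, mul_one]
      exact mem_support_iff.1 hd
    obtain ⟨_, ⟨l0, hl0, hl0n, rfl⟩, hle0⟩ := hp2 _ hd'
    obtain ⟨l, hperm, hsort⟩ : ∃ l : List ℕ, l.Perm l0 ∧ l.Pairwise (· ≥ ·) :=
      ⟨l0.insertionSort (· ≥ ·), List.perm_insertionSort _ _, List.pairwise_insertionSort _ _⟩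
    have hl : l.length = t := hperm.length_eq.trans hl0
    have hln : ∀ i ∈ l, i < n := fun i hi => hl0n i (hperm.mem_iff.1 hi)
    rw [← (hperm.map (eexp (n + m) m)).sum_eq] at hle0
    have hle : ∀ v : Fin (n + m), l.countP (fun i => decide (i ≤ v.val ∧ v.val < i + m)) ≤
        d v + s * (if n ≤ v.val then 1 else 0) := by
      intro v
      have := hle0 v
      rw [sum_eexp_apply, Finsupp.add_apply, Finsupp.smul_apply, eexp_apply, smul_eq_mul] at this
      have hv := v.isLt
      simpa [hv] using this
    have hbig : ∀ (l' : List ℕ), (∀ i ∈ l', i < n) → ∀ v : Fin (n + m), n - 1 ≤ v.val →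
        l'.countP (fun i => decide (i ≤ v.val ∧ v.val < i + m)) =
        l'.countP (fun i => decide (v.val + 1 - m ≤ i)) := by
      intro l' hl' v hv
      apply List.countP_congr
      intro i hi
      have := hl' i hi
      simp only [decide_eq_true_eq]
      omega
    suffices h : monomial d (1 : k) ∈ A ^ (t - s + 1) * (A + Ideal.span {xn}) ^ (s - 1)
        + Ideal.span {xn ^ s} * J ^ (t - s) by
      have h2 : monomial d (coeff d p) = C (coeff d p) * monomial d (1 : k) := by
        rw [C_mul_monomial, mul_one]
      rw [h2]
      exact Ideal.mul_mem_left _ _ h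
    have hb := hle ⟨n - 1, by omega⟩
    rw [hbig l hln _ le_rfl] at hb
    simp only [] at hb
    rw [if_neg (by omega)] at hb
    have e1 : n - 1 + 1 - m = n - m := by omega
    rw [e1] at hb
    by_cases hbs : s ≤ l.countP (fun i => decide (n - m ≤ i))
    · apply Ideal.mem_sup_right
      have hdropn : ∀ i ∈ l.drop s, i < n := fun i hi => hln i (List.mem_of_mem_drop hi)
      have hQ := mon_list_mem (m := m) J (l.drop s) (fun i hi => hfJ i (hdropn i hi))
      rw [List.length_drop, hl] at hQ
      have hX := Ideal.mul_mem_mul (Ideal.mem_span_singleton_self (xn ^ s)) hQ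
      rw [hxpow s, monomial_mul, one_mul, ← hxpow s] at hX
      refine mon_mem_of_le _ ?_ hX
      intro v
      rw [Finsupp.add_apply, sum_eexp_apply, Finsupp.single_apply]
      have hv := hle v
      simp only [Fin.ext_iff]
      by_cases h1 : n - 1 ≤ v.val
      · rw [hbig _ hdropn v h1, count_drop l hsort]
        rw [hbig _ hln v h1] at hv
        by_cases h2 : n - 1 = v.val
        · rw [if_pos h2]
          rw [if_neg (by omega)] at hv
          have e2 : v.val + 1 - m = n - m := by omega
          rw [e2] at hv ⊢
          omega
        · rw [if_neg h2]
          rw [if_pos (by omega)] at hv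
          omega
      · rw [if_neg (by omega)]
        rw [if_neg (by omega)] at hv
        have := (List.drop_sublist s l).countP_le
          (p := fun i => decide (i ≤ v.val ∧ v.val < i + m))
        omega
    · apply Ideal.mem_sup_left
      set b := l.countP (fun i => decide (n - m ≤ i)) with hbdef
      have hlen : (l.filter (fun i => decide (i < n - m))).length = t - b := by
        have h1 := List.length_eq_countP_add_countP (fun i => decide (n - m ≤ i)) (l := l)
        rw [← List.countP_eq_length_filter]
        have h2 : l.countP (fun i => decide (i < n - m)) =
            l.countP (fun a => decide ¬(decide (n - m ≤ a)) = true) := by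
          apply List.countP_congr
          intro i hi
          simp
          omega
        omega
      have hQ := mon_list_mem (m := m) A (l.filter (fun i => decide (i < n - m)))
        (fun i hi => hfA i (by simpa using (List.mem_filter.1 hi).2))
      rw [hlen] at hQ
      have hX := Ideal.mul_mem_mul hQ (Ideal.mem_span_singleton_self (xn ^ b))
      have hsub : A ^ (t - b) * Ideal.span {xn ^ b} ≤
          A ^ (t - s + 1) * (A + Ideal.span {xn}) ^ (s - 1) := by
        have e3 : t - b = (t - s + 1) + (s - 1 - b) := by omega
        have e4 : s - 1 = (s - 1 - b) + b := by omega
        have h5 : A ^ (s - 1 - b) * Ideal.span {xn} ^ b ≤ (A + Ideal.span {xn}) ^ (s - 1) := by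
          conv_rhs => rw [e4, pow_add]
          exact Ideal.mul_mono (Ideal.pow_right_mono le_sup_left _)
            (Ideal.pow_right_mono le_sup_right _)
        rw [e3, pow_add, mul_assoc, ← Ideal.span_singleton_pow]
        exact Ideal.mul_mono_right h5
      have hX := hsub hX
      rw [hxpow b, monomial_mul, one_mul] at hX
      refine mon_mem_of_le _ ?_ hX
      intro v
      rw [Finsupp.add_apply, sum_eexp_apply, Finsupp.single_apply]
      have hv := hle v
      by_cases h1 : n - 1 ≤ v.val
      · have h0 : (l.filter (fun i => decide (i < n - m))).countP
            (fun i => decide (i ≤ v.val ∧ v.val < i + m)) = 0 := by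
          rw [List.countP_eq_zero]
          intro i hi
          have := (List.mem_filter.1 hi).2
          simp only [decide_eq_true_eq] at this ⊢
          omega
        rw [h0, zero_add]
        split_ifs with h2
        · rw [← h2]; omega
        · omega
      · rw [if_neg (by simp only [Fin.ext_iff]; omega)]
        rw [if_neg (by omega)] at hv
        have := (List.filter_sublist (p := fun i => decide (i < n - m)) (l := l)).countP_le
          (p := fun i => decide (i ≤ v.val ∧ v.val < i + m))
        omega
  · have key : (A ^ (t - s + 1) * (A + Ideal.span {xn}) ^ (s - 1)
        + Ideal.span {xn ^ s} * J ^ (t - s)) * Ideal.span {f n ^ s} ≤ J ^ t := by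
      rw [add_mul]
      refine sup_le ?_ ?_
      · have h1 : (A + Ideal.span {xn}) * Ideal.span {f n} ≤ J := by
          rw [add_mul]
          refine sup_le (Ideal.mul_le_left.trans hAJ) ?_
          simpa using hxfs 1
        have h2 : Ideal.span {f n ^ s} ≤ Ideal.span {f n} ^ (s - 1) := by
          rw [← Ideal.span_singleton_pow]
          exact Ideal.pow_le_pow_right (by omega)
        calc _ ≤ A ^ (t - s + 1) * (A + Ideal.span {xn}) ^ (s - 1) * Ideal.span {f n} ^ (s - 1) :=
              Ideal.mul_mono_right h2
          _ = A ^ (t - s + 1) * ((A + Ideal.span {xn}) * Ideal.span {f n}) ^ (s - 1) := by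
              rw [mul_assoc, mul_pow]
          _ ≤ J ^ (t - s + 1) * J ^ (s - 1) :=
              Ideal.mul_mono (Ideal.pow_right_mono hAJ _) (Ideal.pow_right_mono h1 _)
          _ = J ^ t := by rw [← pow_add]; congr 1; omega
      · calc _ = (Ideal.span {xn ^ s} * Ideal.span {f n ^ s}) * J ^ (t - s) := by ring
          _ ≤ J ^ s * J ^ (t - s) := Ideal.mul_mono_left (hxfs s)
          _ = J ^ t := by rw [← pow_add]; congr 1; omega
    intro p hp
    rw [Submodule.mem_colon]
    intro q hq
    exact key (Ideal.mul_mem_mul hp hq)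
end

section
/- Assume n ≥ m and let t ≥ 1 and s ≥ 0 be integers. Then (f_{n+1}^t · J^s) ∩ (J^{s+1} I_{n,m}^{t-1}) = f_{n+1}^t · J^s · (A + (x_n)). -/
open MvPolynomial

namespace PathAux

/-- Exponent of the `i`-th generator. -/
noncomputable def E (n m i : ℕ) : Fin (n + m) →₀ ℕ :=
  Finsupp.equivFunOnFinite.symm (fun v => if i ≤ v.val ∧ v.val < i + m then 1 else 0)

lemma E_apply (n m i : ℕ) (v : Fin (n + m)) :
    E n m i v = if i ≤ v.val ∧ v.val < i + m then 1 else 0 := rfl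

lemma f_eq (k : Type*) [Field k] (m n : ℕ) (i : ℕ)
    (x : Fin m → Fin (n + m)) (hx : ∀ j, (x j).val = i + j.val) :
    (∏ j : Fin m, X (x j) :
      MvPolynomial (Fin (n + m)) k) = monomial (E n m i) 1 := by
  have h1 : E n m i = ∑ j : Fin m,
      Finsupp.single (x j) 1 := by
    ext v
    rw [E_apply, Finsupp.finsetSum_apply]
    simp only [Finsupp.single_apply]
    by_cases h : i ≤ v.val ∧ v.val < i + m
    · rw [if_pos h, Finset.sum_eq_single (⟨v.val - i, by omega⟩ : Fin m)]
      · rw [if_pos]; ext; rw [hx]; simp; omega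
      · intro b _ hb
        rw [if_neg]
        intro h2
        apply hb
        have := congrArg Fin.val h2
        rw [hx] at this
        ext; simp at this ⊢; omega
      · simp
    · rw [if_neg h]
      symm
      apply Finset.sum_eq_zero
      intro b _
      rw [if_neg]
      intro h2
      have := congrArg Fin.val h2
      rw [hx] at this
      have := b.isLt
      omega
  rw [h1, monomial_sum_one]
  rfl

lemma pre_sum (n m : ℕ) (hm : 1 ≤ m) (a : ℕ → ℕ) (v : ℕ) (hv : v < n + m) :
    (∑ i ∈ Finset.range n, a i * (if i ≤ v ∧ v < i + m then 1 else 0))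
      + ∑ i ∈ Finset.range (v + 1 - m), a i = ∑ i ∈ Finset.range (min (v + 1) n), a i := by
  rw [← Finset.sum_range_add_sum_Ico a (show v + 1 - m ≤ min (v + 1) n by omega), add_comm]
  congr 1
  simp only [mul_ite, mul_one, mul_zero]
  rw [← Finset.sum_filter]
  apply Finset.sum_congr _ (fun _ _ => rfl)
  ext i
  simp only [Finset.mem_filter, Finset.mem_range, Finset.mem_Ico]
  omega

/-- Exponent vector of a product of generators. -/
noncomputable def W (n m N : ℕ) (a : ℕ → ℕ) : Fin (n + m) →₀ ℕ :=
  ∑ i ∈ Finset.range N, a i • E n m i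

lemma W_apply (n m N : ℕ) (a : ℕ → ℕ) (v : Fin (n + m)) :
    W n m N a v = ∑ i ∈ Finset.range N, a i * (if i ≤ v.val ∧ v.val < i + m then 1 else 0) := by
  simp [W, Finsupp.finsetSum_apply, E_apply]

/-- Ideal spanned by monomials. -/
noncomputable def M (k : Type*) [Field k] {σ : Type*} (S : Set (σ →₀ ℕ)) : Ideal (MvPolynomial σ k) :=
  Ideal.span ((fun s => monomial s (1 : k)) '' S)

lemma M_mul (k : Type*) [Field k] {σ : Type*} (S T U : Set (σ →₀ ℕ))
    (h : ∀ a ∈ S, ∀ b ∈ T, a + b ∈ U) : M k S * M k T ≤ M k U := by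
  unfold M
  rw [Ideal.span_mul_span', Ideal.span_le]
  rintro _ ⟨_, ⟨a, ha, rfl⟩, _, ⟨b, hb, rfl⟩, rfl⟩
  apply Ideal.subset_span
  exact ⟨a + b, h a ha b hb, by simp [monomial_mul]⟩

/-- Exponent vectors of degree `s` products. -/
def P (n m N s : ℕ) : Set (Fin (n + m) →₀ ℕ) :=
  {e | ∃ a : ℕ → ℕ, ∑ i ∈ Finset.range N, a i = s ∧ e = W n m N a}

lemma W_add (n m N : ℕ) (a b : ℕ → ℕ) : W n m N a + W n m N b = W n m N (a + b) := by
  simp [W, add_smul, Finset.sum_add_distrib]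

lemma pow_le (k : Type*) [Field k] (m n N : ℕ) (f : ℕ → MvPolynomial (Fin (n + m)) k)
    (hf : ∀ i < N, f i = monomial (E n m i) 1) (s : ℕ) :
    Ideal.span (f '' Set.Iio N) ^ s ≤ M k (P n m N s) := by
  induction s with
  | zero =>
    have : (1 : MvPolynomial (Fin (n + m)) k) ∈ M k (P n m N 0) := by
      apply Ideal.subset_span
      exact ⟨0, ⟨0, by simp, by simp [W]⟩, rfl⟩
    rw [(Ideal.eq_top_iff_one _).2 this]
    exact le_top
  | succ s ih =>
    rw [pow_succ]
    have h1 : Ideal.span (f '' Set.Iio N) ≤ M k (P n m N 1) := by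
      rw [Ideal.span_le]
      rintro _ ⟨i, hi, rfl⟩
      apply Ideal.subset_span
      refine ⟨E n m i, ⟨fun j => if j = i then 1 else 0, ?_, ?_⟩, (hf i hi).symm⟩
      · simpa using hi
      · have : i < N := hi
        simp [W, ite_smul, this]
    refine (Ideal.mul_mono ih h1).trans (M_mul k _ _ _ ?_)
    rintro _ ⟨a, ha, rfl⟩ _ ⟨b, hb, rfl⟩
    exact ⟨a + b, by simp [Finset.sum_add_distrib, ha, hb], W_add ..⟩

lemma mem_pow (k : Type*) [Field k] (m n N : ℕ) (f : ℕ → MvPolynomial (Fin (n + m)) k)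
    (hf : ∀ i < N, f i = monomial (E n m i) 1) (L : ℕ) (hL : L ≤ N) (a : ℕ → ℕ) :
    (monomial (W n m L a) (1 : k)) ∈ 
      Ideal.span (f '' Set.Iio N) ^ (∑ i ∈ Finset.range L, a i) := by
  unfold W
  rw [monomial_sum_one, ← Finset.prod_pow_eq_pow_sum]
  apply Ideal.prod_mem_prod
  intro i hi
  have hi : i < N := by have := Finset.mem_range.1 hi; omega
  have : monomial (a i • E n m i) (1 : k) = f i ^ a i := by
    rw [hf i hi, monomial_pow, one_pow]
  rw [this]
  exact Ideal.pow_mem_pow (Ideal.subset_span (Set.mem_image_of_mem f (Set.mem_Iio.2 hi))) _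

lemma mono_mem (k : Type*) [Field k] {σ : Type*} (L : Ideal (MvPolynomial σ k)) (a b : σ →₀ ℕ)
    (h : a ≤ b) (c : k) (ha : monomial a (1 : k) ∈ L) : monomial b c ∈ L := by
  have : monomial b c = monomial (b - a) c * monomial a 1 := by
    rw [monomial_mul, tsub_add_cancel_of_le h, mul_one]
  rw [this]
  exact L.mul_mem_left _ ha

lemma sum_tsub (C : ℕ → ℕ) (hC : Monotone C) (h0 : C 0 = 0) (j : ℕ) :
    ∑ i ∈ Finset.range j, (C (i + 1) - C i) = C j := by
  rw [Finset.sum_range_tsub hC, h0, Nat.sub_zero]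

/-- The combinatorial core. -/
lemma comb (m n s : ℕ) (hm : 2 ≤ m) (hnm : m ≤ n) (y : Fin (n + m) →₀ ℕ)
    (w : Fin (n + m)) (hw : w.val = n - 1) (g h : ℕ → ℕ)
    (hg : ∑ i ∈ Finset.range n, g i = s) (hgy : W n m n g ≤ y)
    (hh : s + 1 ≤ ∑ i ∈ Finset.range n, h i)
    (hhy : ∀ v : Fin (n + m), v.val < n → W n m n h v ≤ y v) :
    (s + 1 ≤ ∑ i ∈ Finset.range (n - m), h i ∧ W n m (n - m) h ≤ y) ∨
    ∃ c : ℕ → ℕ, ∑ i ∈ Finset.range n, c i = s ∧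
      W n m n c + Finsupp.single w 1 ≤ y := by
  by_cases hp : s + 1 ≤ ∑ i ∈ Finset.range (n - m), h i
  · left
    refine ⟨hp, fun v => ?_⟩
    by_cases hv : v.val < n
    · refine le_trans ?_ (hhy v hv)
      rw [W_apply, W_apply]
      exact Finset.sum_le_sum_of_subset (Finset.range_mono (by omega))
    · rw [W_apply, Finset.sum_eq_zero]
      · exact Nat.zero_le _
      · intro i hi
        have := Finset.mem_range.1 hi
        rw [if_neg (by omega), mul_zero]
  · right
    have mono : ∀ a : ℕ → ℕ, Monotone (fun j => ∑ i ∈ Finset.range j, a i) := by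
      intro a i j hij
      exact Finset.sum_le_sum_of_subset (Finset.range_mono hij)
    obtain ⟨G, hG⟩ : ∃ G : ℕ → ℕ, G = fun j => ∑ i ∈ Finset.range j, g i := ⟨_, rfl⟩
    obtain ⟨H, hH⟩ : ∃ H : ℕ → ℕ, H = fun j => ∑ i ∈ Finset.range j, h i := ⟨_, rfl⟩
    have mG : Monotone G := hG ▸ mono g
    have mH : Monotone H := hH ▸ mono h
    have G0 : G 0 = 0 := by simp [hG]
    have H0 : H 0 = 0 := by simp [hH]
    have Gn : G n = s := by rw [hG]; exact hg
    have Hn : s + 1 ≤ H n := by rw [hH]; exact hh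
    have Hp : ¬ (s + 1 ≤ H (n - m)) := by rw [hH]; exact hp
    obtain ⟨C, hC⟩ : ∃ C : ℕ → ℕ, C = fun j => max (G j) (H (min j (n - m))) := ⟨_, rfl⟩
    have mC : Monotone C := by
      rw [hC]; intro i j hij
      exact max_le_max (mG hij) (mH (min_le_min_right _ hij))
    have C0 : C 0 = 0 := by simp [hC, G0, H0]
    have hCj : ∀ j, C j = max (G j) (H (min j (n - m))) := fun j => by rw [hC]
    refine ⟨fun i => C (i + 1) - C i, ?_, ?_⟩
    · rw [sum_tsub C mC C0, hCj, min_eq_right (by omega)]; omega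
    · intro v
      have e1 := pre_sum n m (by omega) (fun i => C (i + 1) - C i) v.val v.isLt
      rw [sum_tsub C mC C0, sum_tsub C mC C0] at e1
      have e2 := pre_sum n m (by omega) g v.val v.isLt
      have e3 := pre_sum n m (by omega) h v.val v.isLt
      rw [← W_apply] at e1 e2 e3
      have e2' : W n m n g v + G (v.val + 1 - m) = G (min (v.val + 1) n) := by rw [hG]; exact e2
      have e3' : W n m n h v + H (v.val + 1 - m) = H (min (v.val + 1) n) := by rw [hH]; exact e3
      have l2 := hgy v
      rw [Finsupp.add_apply, Finsupp.single_apply]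
      have k1 := hCj (v.val + 1 - m)
      have k2 := hCj (min (v.val + 1) n)
      by_cases hv : v.val < n
      · have l3 := hhy v hv
        rw [min_eq_left (show v.val + 1 ≤ n by omega)] at e1 e2' e3' k2
        rw [min_eq_left (show v.val + 1 - m ≤ n - m by omega)] at k1
        have := mH (min_le_left (v.val + 1) (n - m))
        split_ifs with hvn
        · have hv' : v.val + 1 = n := by
            have := congrArg Fin.val hvn
            omega
          rw [hv'] at e1 e2' e3' k1 k2
          rw [min_eq_right (by omega)] at k2
          omega
        · omega
      · rw [if_neg (by intro h; apply hv; rw [← h]; omega)]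
        rw [min_eq_right (show n ≤ v.val + 1 by omega)] at e1 e2' e3' k2
        rw [min_eq_right (show n - m ≤ v.val + 1 - m by omega)] at k1
        rw [min_eq_right (show n - m ≤ n by omega)] at k2
        omega

end PathAux

open PathAux in
theorem stmt_2 (k : Type*) [Field k] (m n : ℕ) (hm : 2 ≤ m) (hnm : m ≤ n)
    (f : ℕ → MvPolynomial (Fin (n + m)) k)
    (hf : ∀ i, ∀ hi : i ≤ n, f i = ∏ j : Fin m,
      X (⟨i + j.val, by have := j.isLt; omega⟩ : Fin (n + m)))
    (I J A : Ideal (MvPolynomial (Fin (n + m)) k))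
    (hI : I = Ideal.span (f '' Set.Iic n))
    (hJ : J = Ideal.span (f '' Set.Iio n))
    (hA : A = Ideal.span (f '' Set.Iio (n - m)))
    (xn : MvPolynomial (Fin (n + m)) k)
    (hxn : xn = X (⟨n - 1, by omega⟩ : Fin (n + m)))
    (t s : ℕ) (ht : 1 ≤ t) :
    (Ideal.span {f n ^ t} * J ^ s) ⊓ (J ^ (s + 1) * I ^ (t - 1)) =
      Ideal.span {f n ^ t} * J ^ s * (A + Ideal.span {xn}) := by
  have hf' : ∀ i ≤ n, f i = monomial (E n m i) 1 := fun i hi => by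
    rw [hf i hi, f_eq k m n i _ (fun _ => rfl)]
  have hAJ : A ≤ J := by
    rw [hA, hJ]
    exact Ideal.span_mono (Set.image_mono (Set.Iio_subset_Iio (by omega)))
  have hfI : f n ∈ I := hI ▸ Ideal.subset_span ⟨n, le_refl n, rfl⟩
  apply le_antisymm
  · intro p hp
    obtain ⟨hp1, hp2⟩ := hp
    have q1 : Ideal.span {f n ^ t} * J ^ s ≤
        M k {e | ∃ g : ℕ → ℕ, ∑ i ∈ Finset.range n, g i = s ∧ e = t • E n m n + W n m n g} := by
      have : Ideal.span {f n ^ t} ≤ M k {t • E n m n} := by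
        rw [Ideal.span_singleton_le_iff_mem]
        apply Ideal.subset_span
        exact ⟨_, rfl, by simp [hf' n le_rfl, monomial_pow]⟩
      refine (Ideal.mul_mono this
        (hJ ▸ pow_le k m n n f (fun i hi => hf' i hi.le) s)).trans (M_mul k _ _ _ ?_)
      rintro _ rfl _ ⟨g, hg, rfl⟩
      exact ⟨g, hg, rfl⟩
    have q2 : J ^ (s + 1) * I ^ (t - 1) ≤
        M k {e | ∃ g h : ℕ → ℕ, ∑ i ∈ Finset.range n, g i = s + 1 ∧ e = W n m n g + W n m (n + 1) h} := by
      have hI' : I = Ideal.span (f '' Set.Iio (n + 1)) := by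
        rw [hI]; congr 2; ext i; simp
      refine (Ideal.mul_mono (hJ ▸ pow_le k m n n f (fun i hi => hf' i hi.le) (s + 1))
        (hI' ▸ pow_le k m n (n + 1) f (fun i hi => hf' i (by omega)) (t - 1))).trans (M_mul k _ _ _ ?_)
      rintro _ ⟨g, hg, rfl⟩ _ ⟨h, hh, rfl⟩
      exact ⟨g, h, hg, rfl⟩
    have r1 := q1 hp1
    have r2 := q2 hp2
    unfold M at r1 r2
    rw [mem_ideal_span_monomial_image] at r1 r2
    rw [p.as_sum]
    apply Ideal.sum_mem
    intro u hu
    obtain ⟨_, ⟨g, hg, rfl⟩, hgu⟩ := r1 u hu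
    obtain ⟨_, ⟨h1, h2, hh, rfl⟩, hhu⟩ := r2 u hu
    have hty : t • E n m n ≤ u := le_trans le_self_add hgu
    obtain ⟨y, rfl⟩ := exists_add_of_le hty
    have hgy : W n m n g ≤ y := le_of_add_le_add_left hgu
    have key := comb m n s hm hnm y ⟨n - 1, by omega⟩ rfl g (h1 + h2) hg hgy
      (by simp [Finset.sum_add_distrib, hh]) (by
        intro v hv
        have a1 := hhu v
        rw [← W_add]
        have a2 : W n m (n + 1) h2 v = W n m n h2 v := by
          rw [W_apply, W_apply, Finset.sum_range_succ, if_neg (by omega)]; simp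
        have a3 : E n m n v = 0 := by rw [E_apply, if_neg (by omega)]
        simp only [Finsupp.add_apply, Finsupp.smul_apply, a2, a3] at a1 ⊢
        simpa using a1)
    have hc : monomial (t • E n m n + y) (coeff (t • E n m n + y) p) =
        f n ^ t * monomial y (coeff (t • E n m n + y) p) := by
      rw [hf' n le_rfl, monomial_pow, monomial_mul]; simp
    rw [hc, mul_assoc]
    apply Ideal.mul_mem_mul (Ideal.mem_span_singleton_self _)
    rcases key with ⟨b1, b2⟩ | ⟨c, hc1, hc2⟩
    · apply mono_mem k _ _ _ b2
      have b3 := mem_pow k m n (n - m) f (fun i hi => hf' i (by omega)) (n - m) le_rfl (h1 + h2)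
      rw [← hA] at b3
      have b4 := Ideal.pow_le_pow_right b1 b3
      rw [pow_succ] at b4
      exact Ideal.mul_mono (Ideal.pow_right_mono hAJ s) le_sup_left b4
    · apply mono_mem k _ _ _ hc2
      have b3 := mem_pow k m n n f (fun i hi => hf' i hi.le) n le_rfl c
      rw [hc1, ← hJ] at b3
      have b5 : xn ∈ A + Ideal.span {xn} := 
        (le_sup_right : Ideal.span {xn} ≤ A ⊔ Ideal.span {xn}) (Ideal.mem_span_singleton_self _)
      have b6 := Ideal.mul_mem_mul b3 b5
      rw [hxn, X, monomial_mul, mul_one] at b6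
      rw [hxn]
      exact b6
  · apply le_inf
    · exact Ideal.mul_le_left
    · obtain ⟨r, rfl⟩ : ∃ r, t = r + 1 := ⟨t - 1, by omega⟩
      have h1 : Ideal.span {f n} * (A + Ideal.span {xn}) ≤ J := by
        rw [mul_add]
        refine sup_le (Ideal.mul_le_right.trans hAJ) ?_
        rw [Ideal.span_singleton_mul_span_singleton, Ideal.span_singleton_le_iff_mem]
        have : f n * xn = X (⟨n + m - 1, by omega⟩ : Fin (n + m)) * f (n - 1) := by
          rw [hxn, hf' n le_rfl, hf' (n - 1) (by omega), X, X, monomial_mul, monomial_mul]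
          refine congrArg (fun e => monomial e ((1 : k) * 1)) ?_
          ext v
          simp only [Finsupp.add_apply, E_apply, Finsupp.single_apply, Fin.ext_iff]
          have := v.isLt
          split_ifs <;> omega
        rw [this]
        apply Ideal.mul_mem_left
        rw [hJ]
        exact Ideal.subset_span ⟨n - 1, by simp; omega, rfl⟩
      have h2 : Ideal.span {f n ^ r} ≤ I ^ r := by
        rw [Ideal.span_singleton_le_iff_mem]
        exact Ideal.pow_mem_pow hfI r
      calc Ideal.span {f n ^ (r + 1)} * J ^ s * (A + Ideal.span {xn})
          = J ^ s * (Ideal.span {f n} * (A + Ideal.span {xn})) * Ideal.span {f n ^ r} := by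
            rw [pow_succ, ← Ideal.span_singleton_mul_span_singleton]; ring
        _ ≤ J ^ s * J * I ^ r := Ideal.mul_mono (Ideal.mul_mono le_rfl h1) h2
        _ = _ := by rw [pow_succ]; simp
end

section
/- Assume n ≥ m and let s ≥ 0 be an integer. Then J^s(A + (x_n)) = A^{s+1} + x_n J^s. -/
open MvPolynomial

/-- Assume `n ≥ m` and let `s ≥ 0` be an integer. Then
`J^s (A + (x_n)) = A^{s+1} + x_n J^s`, where `J = (f_1, …, f_n)`,
`A = (f_1, …, f_{n-m})` and `f_i = x_i ⋯ x_{i+m-1}`. Generators are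
0-indexed: `f i` for `0 ≤ i ≤ n` is the paper's `f_{i+1}`; `x_n` is
`X ⟨n-1, _⟩`. -/
theorem stmt_3 (k : Type*) [Field k] (m n : ℕ) (hm : 2 ≤ m) (hnm : m ≤ n)
    (f : ℕ → MvPolynomial (Fin (n + m)) k)
    (hf : ∀ i, ∀ hi : i ≤ n, f i = ∏ j : Fin m,
      X (⟨i + j.val, by have := j.isLt; omega⟩ : Fin (n + m)))
    (J A : Ideal (MvPolynomial (Fin (n + m)) k))
    (hJ : J = Ideal.span (f '' Set.Iio n))
    (hA : A = Ideal.span (f '' Set.Iio (n - m)))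
    (xn : MvPolynomial (Fin (n + m)) k)
    (hxn : xn = X (⟨n - 1, by omega⟩ : Fin (n + m)))
    (s : ℕ) :
    J ^ s * (A + Ideal.span {xn}) = A ^ (s + 1) + Ideal.span {xn} * J ^ s := by
  have hAJ : A ≤ J := by
    rw [hA, hJ]
    exact Ideal.span_mono (Set.image_mono (Set.Iio_subset_Iio (Nat.sub_le n m)))
  have hJA : J ≤ A + Ideal.span {xn} := by
    rw [hJ, Ideal.span_le]
    rintro _ ⟨i, hi, rfl⟩
    have hi' : i < n := hi
    by_cases h : i < n - m
    · refine Ideal.mem_sup_left ?_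
      rw [hA]
      exact Ideal.subset_span ⟨i, h, rfl⟩
    · refine Ideal.mem_sup_right ?_
      rw [Ideal.mem_span_singleton, hf i hi'.le, hxn]
      have key := Finset.dvd_prod_of_mem
        (fun j : Fin m => (X (⟨i + j.val, by have := j.isLt; omega⟩ : Fin (n + m)) :
          MvPolynomial (Fin (n + m)) k))
        (Finset.mem_univ (⟨n - 1 - i, by omega⟩ : Fin m))
      have e : i + (n - 1 - i) = n - 1 := by omega
      simpa only [e] using key
  have main : ∀ s : ℕ, J ^ s * A ≤ A ^ (s + 1) + Ideal.span {xn} * J ^ s := by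
    intro s
    induction s with
    | zero => simp
    | succ s ih =>
      have h1 : J * A ^ (s + 1) ≤ A ^ (s + 2) + Ideal.span {xn} * J ^ (s + 1) := by
        calc J * A ^ (s + 1) ≤ (A + Ideal.span {xn}) * A ^ (s + 1) := Ideal.mul_mono_left hJA
          _ = A ^ (s + 2) + Ideal.span {xn} * A ^ (s + 1) := by ring
          _ ≤ _ := sup_le_sup le_rfl (Ideal.mul_mono_right (Ideal.pow_right_mono hAJ _))
      calc J ^ (s + 1) * A = J * (J ^ s * A) := by ring
        _ ≤ J * (A ^ (s + 1) + Ideal.span {xn} * J ^ s) := Ideal.mul_mono_right ih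
        _ = J * A ^ (s + 1) + Ideal.span {xn} * J ^ (s + 1) := by ring
        _ ≤ _ := sup_le h1 le_sup_right
  rw [mul_add, mul_comm (J ^ s) (Ideal.span {xn})]
  apply le_antisymm
  · exact sup_le (main s) le_sup_right
  · refine sup_le_sup ?_ le_rfl
    rw [pow_succ]
    exact Ideal.mul_mono_left (Ideal.pow_right_mono hAJ _)
end

section
/- Assume n ≥ m and let s ≥ 0 be an integer. Then A^{s+1} ∩ (x_n J^s) = x_n A^{s+1}. -/
open MvPolynomial

theorem aux_pow {σ k : Type*} [Field k] (p : σ) (T0 : Set (σ →₀ ℕ)) (h0 : ∀ d ∈ T0, d p = 0) (t : ℕ) :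
    ∃ T : Set (σ →₀ ℕ), (∀ d ∈ T, d p = 0) ∧
      (Ideal.span ((fun d => monomial d (1 : k)) '' T0)) ^ t =
        Ideal.span ((fun d => monomial d (1 : k)) '' T) := by
  induction t with
  | zero =>
    refine ⟨{0}, by simp, ?_⟩
    simp [Ideal.one_eq_top]
  | succ t ih =>
    obtain ⟨T, hT, e⟩ := ih
    refine ⟨Set.image2 (· + ·) T T0, ?_, ?_⟩
    · rintro _ ⟨a, ha, b, hb, rfl⟩
      simp [hT a ha, h0 b hb]
    · rw [pow_succ, e, Ideal.span_mul_span']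
      congr 1
      ext q
      constructor
      · rintro ⟨_, ⟨a, ha, rfl⟩, _, ⟨b, hb, rfl⟩, rfl⟩
        exact ⟨a + b, ⟨a, ha, b, hb, rfl⟩, by simp [monomial_mul]⟩
      · rintro ⟨_, ⟨a, ha, b, hb, rfl⟩, rfl⟩
        exact ⟨_, ⟨a, ha, rfl⟩, _, ⟨b, hb, rfl⟩, by simp [monomial_mul]⟩

theorem aux_cancel {σ k : Type*} [Field k] (p : σ) (T : Set (σ →₀ ℕ)) (hT : ∀ d ∈ T, d p = 0)
    (g : MvPolynomial σ k)
    (h : X p * g ∈ Ideal.span ((fun d => monomial d (1 : k)) '' T)) :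
    g ∈ Ideal.span ((fun d => monomial d (1 : k)) '' T) := by
  classical
  rw [mem_ideal_span_monomial_image] at h ⊢
  intro d hd
  obtain ⟨e, he, hle⟩ := h (Finsupp.single p 1 + d) (by
    rw [mem_support_iff] at hd ⊢
    rwa [coeff_X_mul])
  refine ⟨e, he, fun i => ?_⟩
  by_cases hi : i = p
  · subst hi; simp [hT e he]
  · have := hle i
    simpa [Finsupp.single_apply, Ne.symm hi] using this


/-- Assume `n ≥ m` and let `s ≥ 0` be an integer. Then
`A^{s+1} ∩ (x_n J^s) = x_n A^{s+1}`, where `J = (f_1, …, f_n)`,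
`A = (f_1, …, f_{n-m})` and `f_i = x_i ⋯ x_{i+m-1}`. Generators are
0-indexed: `f i` for `0 ≤ i ≤ n` is the paper's `f_{i+1}`; `x_n` is
`X ⟨n-1, _⟩`. -/
theorem stmt_4 (k : Type*) [Field k] (m n : ℕ) (hm : 2 ≤ m) (hnm : m ≤ n)
    (f : ℕ → MvPolynomial (Fin (n + m)) k)
    (hf : ∀ i, ∀ hi : i ≤ n, f i = ∏ j : Fin m,
      X (⟨i + j.val, by have := j.isLt; omega⟩ : Fin (n + m)))
    (J A : Ideal (MvPolynomial (Fin (n + m)) k))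
    (hJ : J = Ideal.span (f '' Set.Iio n))
    (hA : A = Ideal.span (f '' Set.Iio (n - m)))
    (xn : MvPolynomial (Fin (n + m)) k)
    (hxn : xn = X (⟨n - 1, by omega⟩ : Fin (n + m)))
    (s : ℕ) :
    A ^ (s + 1) ⊓ (Ideal.span {xn} * J ^ s) = Ideal.span {xn} * A ^ (s + 1) := by
  have hAT : A = Ideal.span ((fun d => monomial d (1 : k)) ''
      {d | d (⟨n - 1, by omega⟩ : Fin (n + m)) = 0 ∧ ∃ i < n - m, f i = monomial d 1}) := by
    rw [hA]
    congr 1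
    ext q
    constructor
    · rintro ⟨i, hi, rfl⟩
      have hi' : i < n - m := hi
      have e : f i = monomial (∑ j : Fin m, Finsupp.single
          (⟨i + j.val, by have := j.isLt; omega⟩ : Fin (n + m)) 1) 1 := by
        rw [hf i (by omega), monomial_sum_one]
        rfl
      refine ⟨_, ⟨?_, i, hi', e⟩, e.symm⟩
      rw [Finsupp.finsetSum_apply]
      refine Finset.sum_eq_zero fun j _ => ?_
      rw [Finsupp.single_apply, if_neg]
      intro h
      have := congrArg Fin.val h
      have := j.isLt
      simp only at *
      omega
    · rintro ⟨d, ⟨_, i, hi, e⟩, rfl⟩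
      exact ⟨i, hi, e⟩
  obtain ⟨T, hT, e⟩ := aux_pow (k := k) (⟨n - 1, by omega⟩ : Fin (n + m)) _
    (fun d (hd : d ∈ {d | d (⟨n - 1, by omega⟩ : Fin (n + m)) = 0 ∧
      ∃ i < n - m, f i = monomial d 1}) => hd.1) (s + 1)
  rw [← hAT] at e
  have hAJ : A ≤ J := by
    rw [hA, hJ]
    refine Ideal.span_mono (Set.image_mono fun i (hi : i < n - m) => ?_)
    show i < n
    omega
  apply le_antisymm
  · rintro q ⟨h1, h2⟩
    obtain ⟨g, _, rfl⟩ := Ideal.mem_span_singleton_mul.1 h2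
    refine Ideal.mem_span_singleton_mul.2 ⟨g, ?_, rfl⟩
    rw [SetLike.mem_coe, e, hxn] at h1
    rw [e]
    exact aux_cancel _ T hT g h1
  · exact le_inf Ideal.mul_le_right
      (Ideal.mul_mono_right ((Ideal.pow_le_pow_right (Nat.le_succ s)).trans
        (Ideal.pow_right_mono hAJ s)))
end

section
/- Assume n ≥ m, let g = x_{n+1} x_{n+2} ⋯ x_{n+m-1}, and let t ≥ s ≥ 1 and 0 ≤ i ≤ t be integers. Then the ideal quotient (A^i (x_n B)^{t-i}) : g^s equals A^i x_n^{t-i} B^{t-i-s} if i ≤ t-s, and equals A^i (x_n^{t-i}) if i > t-s. -/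
open MvPolynomial

open Pointwise in
/-- Elements of an iterated sumset. -/
def SumPow {M : Type*} [AddCommMonoid M] (E : Set M) : ℕ → Set M
  | 0 => {0}
  | r + 1 => {b | ∃ e ∈ E, ∃ b' ∈ SumPow E r, b = e + b'}

lemma span_mon_mul {k σ : Type*} [CommSemiring k] (E F : Set (σ →₀ ℕ)) :
    Ideal.span ((fun s => monomial s (1 : k)) '' E) * Ideal.span ((fun s => monomial s (1 : k)) '' F)
      = Ideal.span ((fun s => monomial s (1 : k)) '' {b | ∃ e ∈ E, ∃ b' ∈ F, b = e + b'}) := by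
  rw [Ideal.span_mul_span']
  congr 1
  ext p
  simp only [Set.mem_mul, Set.mem_image, Set.mem_ofPred_eq]
  constructor
  · rintro ⟨_, ⟨a, ha, rfl⟩, _, ⟨b, hb, rfl⟩, rfl⟩
    exact ⟨a + b, ⟨a, ha, b, hb, rfl⟩, by simp [monomial_mul]⟩
  · rintro ⟨_, ⟨a, ha, b, hb, rfl⟩, rfl⟩
    exact ⟨_, ⟨a, ha, rfl⟩, _, ⟨b, hb, rfl⟩, by simp [monomial_mul]⟩

lemma span_mon_pow {k σ : Type*} [CommSemiring k] (E : Set (σ →₀ ℕ)) (r : ℕ) :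
    Ideal.span ((fun s => monomial s (1 : k)) '' E) ^ r
      = Ideal.span ((fun s => monomial s (1 : k)) '' SumPow E r) := by
  induction r with
  | zero => simp [SumPow, Ideal.one_eq_top, Ideal.span_singleton_one]
  | succ r ih => rw [pow_succ', ih, span_mon_mul]; rfl

lemma sumPow_extract {σ : Type*} (E : Set (σ →₀ ℕ)) (L : Set σ)
    (hE : ∀ e ∈ E, ∀ e' ∈ E, (∀ l ∈ L, e l ≤ e' l) ∨ (∀ l ∈ L, e' l ≤ e l)) (r : ℕ) :
    ∀ b ∈ SumPow E (r + 1), ∃ e ∈ E, ∃ b' ∈ SumPow E r, b = e + b' ∧ ∀ l ∈ L, b' l ≤ r * e l := by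
  induction r with
  | zero =>
    rintro b ⟨e, he, b', hb', rfl⟩
    refine ⟨e, he, b', hb', rfl, ?_⟩
    have : b' = 0 := hb'
    simp [this]
  | succ r ih =>
    rintro b ⟨e0, he0, b1, hb1, rfl⟩
    obtain ⟨e1, he1, b', hb', rfl, h⟩ := ih b1 hb1
    rcases hE e0 he0 e1 he1 with h1 | h1
    · refine ⟨e1, he1, e0 + b', ⟨e0, he0, b', hb', rfl⟩, by abel, fun l hl => ?_⟩
      have := h l hl
      have := h1 l hl
      simp only [Finsupp.add_apply]
      nlinarith
    · refine ⟨e0, he0, e1 + b', hb1, rfl, fun l hl => ?_⟩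
      have := h l hl
      have := h1 l hl
      simp only [Finsupp.add_apply]
      nlinarith

lemma sumPow_zero {σ : Type*} (E : Set (σ →₀ ℕ)) (l : σ) (h : ∀ e ∈ E, e l = 0) (r : ℕ) :
    ∀ b ∈ SumPow E r, b l = 0 := by
  induction r with
  | zero => rintro b hb; have : b = 0 := hb; simp [this]
  | succ r ih =>
    rintro b ⟨e, he, b', hb', rfl⟩
    simp [h e he, ih b' hb']

lemma mem_mul_monomial_iff {k σ : Type*} [CommRing k] (E : Set (σ →₀ ℕ)) (γ : σ →₀ ℕ)
    (p : MvPolynomial σ k) :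
    p * monomial γ 1 ∈ Ideal.span ((fun s => monomial s (1 : k)) '' E) ↔
      ∀ u ∈ p.support, ∃ e ∈ E, e ≤ u + γ := by
  rw [mem_ideal_span_monomial_image]
  constructor
  · intro h u hu
    apply h
    rw [mem_support_iff, coeff_mul_monomial, mul_one]
    exact mem_support_iff.1 hu
  · intro h v hv
    rw [mem_support_iff, coeff_mul_monomial'] at hv
    split_ifs at hv with hle
    · rw [mul_one] at hv
      obtain ⟨e, he, hle'⟩ := h _ (mem_support_iff.2 hv)
      refine ⟨e, he, ?_⟩
      rwa [tsub_add_cancel_of_le hle] at hle'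
    · exact absurd rfl hv

lemma core_step {k σ : Type*} [CommRing k] (EA EB : Set (σ →₀ ℕ)) (x γ : σ →₀ ℕ) (L : Set σ)
    (hE : ∀ e ∈ EB, ∀ e' ∈ EB, (∀ l ∈ L, e l ≤ e' l) ∨ (∀ l ∈ L, e' l ≤ e l))
    (hA : ∀ l ∈ L, ∀ e ∈ EA, e l = 0) (hx : ∀ l ∈ L, x l = 0)
    (hγ : γ ∈ EB) (hγ1 : ∀ l, γ l ≤ 1) (hγ0 : ∀ l, l ∉ L → γ l = 0) (i q r : ℕ)
    (p : MvPolynomial σ k) :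
    p * monomial γ 1 ∈ Ideal.span ((fun s => monomial s (1 : k)) '' EA) ^ i *
        Ideal.span {monomial x (1 : k)} ^ q * Ideal.span ((fun s => monomial s (1 : k)) '' EB) ^ r ↔
      p ∈ Ideal.span ((fun s => monomial s (1 : k)) '' EA) ^ i *
        Ideal.span {monomial x (1 : k)} ^ q *
        Ideal.span ((fun s => monomial s (1 : k)) '' EB) ^ (r - 1) := by
  have e1 : ({monomial x (1 : k)} : Set (MvPolynomial σ k)) =
    (fun s => monomial s (1 : k)) '' {x} := by simp
  rw [e1]
  simp only [span_mon_pow, span_mon_mul]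
  rw [mem_mul_monomial_iff, mem_ideal_span_monomial_image]
  refine forall₂_congr fun u _ => ?_
  have hx' : ∀ l ∈ L, ∀ y ∈ SumPow {x} q, y l = 0 := fun l hl =>
    sumPow_zero _ l (by simpa using hx l hl) q
  have hA' : ∀ l ∈ L, ∀ y ∈ SumPow EA i, y l = 0 := fun l hl =>
    sumPow_zero _ l (hA l hl) i
  constructor
  · rintro ⟨_, ⟨_, ⟨a, ha, y, hy, rfl⟩, b, hb, rfl⟩, hle⟩
    rcases r with _ | r
    · refine ⟨_, ⟨_, ⟨a, ha, y, hy, rfl⟩, b, hb, rfl⟩, fun l => ?_⟩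
      have hb0 : b = 0 := hb
      have := hle l
      by_cases hl : l ∈ L
      · simp [hA' l hl a ha, hx' l hl y hy, hb0]
      · simpa [hγ0 l hl] using this
    · obtain ⟨e, he, b', hb', rfl, hh⟩ := sumPow_extract EB L hE r b hb
      refine ⟨_, ⟨_, ⟨a, ha, y, hy, rfl⟩, b', hb', rfl⟩, fun l => ?_⟩
      have h1 := hle l
      by_cases hl : l ∈ L
      · simp only [Finsupp.add_apply, hA' l hl a ha, hx' l hl y hy] at h1 ⊢
        have h2 := hh l hl
        have h3 := hγ1 l
        rcases Nat.eq_zero_or_pos (e l) with h0 | h0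
        · rw [h0] at h2; omega
        · omega
      · simp only [Finsupp.add_apply, hγ0 l hl] at h1 ⊢
        omega
  · rintro ⟨_, ⟨_, ⟨a, ha, y, hy, rfl⟩, b, hb, rfl⟩, hle⟩
    rcases r with _ | r
    · exact ⟨_, ⟨_, ⟨a, ha, y, hy, rfl⟩, b, hb, rfl⟩, hle.trans le_self_add⟩
    · refine ⟨_, ⟨_, ⟨a, ha, y, hy, rfl⟩, γ + b, ⟨γ, hγ, b, hb, rfl⟩, rfl⟩, ?_⟩
      calc a + y + (γ + b) = (a + y + b) + γ := by abel
        _ ≤ _ := by gcongr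

lemma sum_single_apply {N c M : ℕ} (P : ℕ → Prop) [DecidablePred P] (h : c + M ≤ N) (l : Fin N) :
    (∑ j : Fin M, if P (c + j.val) then (0 : Fin N →₀ ℕ) else
      Finsupp.single (⟨c + j.val, by have := j.isLt; omega⟩ : Fin N) 1) l =
      if c ≤ l.val ∧ l.val < c + M ∧ ¬ P l.val then 1 else 0 := by
  rw [Finsupp.finsetSum_apply]
  split_ifs with hc
  · obtain ⟨h1, h2, h3⟩ := hc
    rw [Finset.sum_eq_single (⟨l.val - c, by omega⟩ : Fin M)]
    · have : c + (l.val - c) = l.val := by omega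
      simp [this, h3]
    · intro j _ hj
      have : ¬ c + j.val = l.val := fun hh => hj (Fin.ext (by simp; omega))
      split_ifs
      · rfl
      · rw [Finsupp.single_apply, if_neg]
        intro hh; exact this (congrArg Fin.val hh)
    · simp
  · apply Finset.sum_eq_zero
    intro j _
    split_ifs with hP
    · rfl
    · rw [Finsupp.single_apply, if_neg]
      intro hh
      have hv : c + j.val = l.val := congrArg Fin.val hh
      rw [hv] at hP
      exact hc ⟨by omega, by have := j.isLt; omega, hP⟩

lemma prod_X_eq {k : Type*} [Field k] {N c M : ℕ} (P : ℕ → Prop) [DecidablePred P]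
    (h : c + M ≤ N) :
    (∏ j : Fin M, if P (c + j.val) then (1 : MvPolynomial (Fin N) k) else
      X (⟨c + j.val, by have := j.isLt; omega⟩ : Fin N)) =
    monomial (∑ j : Fin M, if P (c + j.val) then (0 : Fin N →₀ ℕ) else
      Finsupp.single (⟨c + j.val, by have := j.isLt; omega⟩ : Fin N) 1) 1 := by
  rw [monomial_sum_one]
  refine Finset.prod_congr rfl fun j _ => ?_
  split_ifs <;> simp [X]

/-- indicator exponent vector -/
noncomputable def indE (N c M : ℕ) (P : ℕ → Prop) [DecidablePred P] : Fin N →₀ ℕ :=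
  Finsupp.equivFunOnFinite.symm fun l => if c ≤ l.val ∧ l.val < c + M ∧ ¬ P l.val then 1 else 0

lemma indE_apply (N c M : ℕ) (P : ℕ → Prop) [DecidablePred P] (l : Fin N) :
    indE N c M P l = if c ≤ l.val ∧ l.val < c + M ∧ ¬ P l.val then 1 else 0 := rfl

lemma prod_X_eq' {k : Type*} [Field k] {N c M : ℕ} (P : ℕ → Prop) [DecidablePred P]
    (h : c + M ≤ N) :
    (∏ j : Fin M, if P (c + j.val) then (1 : MvPolynomial (Fin N) k) else
      X (⟨c + j.val, by have := j.isLt; omega⟩ : Fin N)) = monomial (indE N c M P) 1 := by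
  rw [prod_X_eq P h]
  have : (∑ j : Fin M, if P (c + j.val) then (0 : Fin N →₀ ℕ) else
      Finsupp.single (⟨c + j.val, by have := j.isLt; omega⟩ : Fin N) 1) = indE N c M P := by
    ext l
    rw [sum_single_apply P h l, indE_apply]
  rw [this]

/-- Assume `n ≥ m`, let `g = x_{n+1} x_{n+2} ⋯ x_{n+m-1}`, and let
`t ≥ s ≥ 1` and `0 ≤ i ≤ t` be integers. Then
`(A^i (x_n B)^{t-i}) : g^s = A^i x_n^{t-i} B^{t-i-s}` if `i ≤ t - s`, and
`(A^i (x_n B)^{t-i}) : g^s = A^i (x_n^{t-i})` if `i > t - s`.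
Here `A = (f_1, …, f_{n-m})`, `B = (g_{n-m+1}, …, g_n)` with `g_i = f_i / x_n`
and `f_i = x_i ⋯ x_{i+m-1}`. Generators are 0-indexed: `f i` (resp. `g i`)
for `0 ≤ i ≤ n` is the paper's `f_{i+1}` (resp. `g_{i+1}`); `x_n` is
`X ⟨n-1, _⟩`, and `G` is the paper's `g = g_n`. -/
theorem stmt_5 (k : Type*) [Field k] (m n : ℕ) (hm : 2 ≤ m) (hnm : m ≤ n)
    (f g : ℕ → MvPolynomial (Fin (n + m)) k)
    (hf : ∀ i, ∀ hi : i ≤ n, f i = ∏ j : Fin m,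
      X (⟨i + j.val, by have := j.isLt; omega⟩ : Fin (n + m)))
    (hg : ∀ i, ∀ hi1 : n - m ≤ i, ∀ hi2 : i < n, g i = ∏ j : Fin m,
      if i + j.val = n - 1 then 1
      else X (⟨i + j.val, by have := j.isLt; omega⟩ : Fin (n + m)))
    (A B : Ideal (MvPolynomial (Fin (n + m)) k))
    (hA : A = Ideal.span (f '' Set.Iio (n - m)))
    (hB : B = Ideal.span (g '' Set.Ico (n - m) n))
    (xn : MvPolynomial (Fin (n + m)) k)
    (hxn : xn = X (⟨n - 1, by omega⟩ : Fin (n + m)))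
    (G : MvPolynomial (Fin (n + m)) k)
    (hG : G = ∏ j : Fin (m - 1),
      X (⟨n + j.val, by have := j.isLt; omega⟩ : Fin (n + m)))
    (t s i : ℕ) (hs : 1 ≤ s) (hst : s ≤ t) (hit : i ≤ t) :
    (i ≤ t - s →
      Submodule.colon (A ^ i * (Ideal.span {xn} * B) ^ (t - i))
          (Ideal.span {G ^ s}) =
        A ^ i * Ideal.span {xn ^ (t - i)} * B ^ (t - i - s)) ∧
    (t - s < i →
      Submodule.colon (A ^ i * (Ideal.span {xn} * B) ^ (t - i))
          (Ideal.span {G ^ s}) =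
        A ^ i * Ideal.span {xn ^ (t - i)}) := by
  have key : Submodule.colon (A ^ i * (Ideal.span {xn} * B) ^ (t - i)) (Ideal.span {G ^ s}) =
        A ^ i * Ideal.span {xn ^ (t - i)} * B ^ (t - i - s) := by
    have hA' : A = Ideal.span ((fun s => monomial s (1 : k)) ''
        ((fun c => indE (n + m) c m (fun _ => False)) '' Set.Iio (n - m))) := by
      rw [hA, Set.image_image]
      congr 1
      refine Set.image_congr fun c hc => ?_
      have hc' : c < n - m := hc
      rw [hf c (by omega), ← prod_X_eq' (fun _ => False) (by omega)]
      simp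
    have hB' : B = Ideal.span ((fun s => monomial s (1 : k)) ''
        ((fun c => indE (n + m) c m (fun l => l = n - 1)) '' Set.Ico (n - m) n)) := by
      rw [hB, Set.image_image]
      congr 1
      refine Set.image_congr fun c hc => ?_
      have hc1 : n - m ≤ c := hc.1
      have hc2 : c < n := hc.2
      rw [hg c hc1 hc2, ← prod_X_eq' (fun l => l = n - 1) (by omega)]
    have hG' : G = monomial (indE (n + m) n (m - 1) (fun _ => False)) 1 := by
      rw [hG, ← prod_X_eq' (fun _ => False) (by omega)]
      simp
    have hstep : ∀ (q r : ℕ) (p : MvPolynomial (Fin (n + m)) k),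
        p * G ∈ A ^ i * Ideal.span {xn} ^ q * B ^ r ↔
          p ∈ A ^ i * Ideal.span {xn} ^ q * B ^ (r - 1) := by
      intro q r p
      rw [hA', hB', hG', hxn]
      refine core_step _ _ (Finsupp.single _ 1) _ {l | n ≤ l.val} ?_ ?_ ?_ ?_ ?_ ?_ i q r p
      · rintro _ ⟨c, hc, rfl⟩ _ ⟨d, hd, rfl⟩
        simp only [indE_apply, Set.mem_ofPred_eq]
        have := hc.2
        have := hd.2
        rcases le_total c d with h | h
        · left; intro l hl; split_ifs <;> omega
        · right; intro l hl; split_ifs <;> omega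
      · rintro l hl _ ⟨c, hc, rfl⟩
        have h1 : n ≤ l.val := hl
        have h2 : c < n - m := hc
        simp only [indE_apply, not_false_eq_true, and_true]
        split_ifs <;> omega
      · intro l hl
        have h1 : n ≤ l.val := hl
        rw [Finsupp.single_apply, if_neg]
        intro hh
        have : n - 1 = l.val := congrArg Fin.val hh
        omega
      · refine ⟨n - 1, ⟨by omega, by omega⟩, ?_⟩
        ext l
        simp only [indE_apply, not_false_eq_true, and_true]
        split_ifs <;> omega
      · intro l
        simp only [indE_apply, not_false_eq_true, and_true]
        split_ifs <;> omega
      · intro l hl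
        have h1 : ¬ n ≤ l.val := hl
        simp only [indE_apply, not_false_eq_true, and_true]
        split_ifs <;> omega
    have hpow : ∀ (q s r : ℕ) (p : MvPolynomial (Fin (n + m)) k),
        p * G ^ s ∈ A ^ i * Ideal.span {xn} ^ q * B ^ r ↔
          p ∈ A ^ i * Ideal.span {xn} ^ q * B ^ (r - s) := by
      intro q s
      induction s with
      | zero => intro r p; simp
      | succ s ih =>
        intro r p
        rw [pow_succ, ← mul_assoc, hstep, ih, Nat.sub_sub, Nat.add_comm 1 s]
    ext p
    rw [← Ideal.span_singleton_pow xn, ← hpow, mul_pow, ← mul_assoc, Submodule.mem_colon]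
    constructor
    · intro h
      exact h _ (Ideal.mem_span_singleton_self _)
    · intro h y hy
      obtain ⟨z, rfl⟩ := Ideal.mem_span_singleton.1 hy
      rw [smul_eq_mul, ← mul_assoc]
      exact Ideal.mul_mem_right _ _ h
  refine ⟨fun _ => key, fun h => ?_⟩
  rw [key, show t - i - s = 0 by omega, pow_zero, mul_one]
end

section
/- Assume n ≥ m and let t ≥ 1 and s ≥ 0 be integers. Then J^s ∩ (J^{s+1} I_{n,m}^{t-1} : f_{n+1}^t) ⊆ J^s(A + (x_n)). -/
open MvPolynomial

lemma cov_eq (m : ℕ) (c : ℕ → ℕ) (j n : ℕ) :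
    (∑ i ∈ Finset.range n, c i * (if i ≤ j ∧ j < i + m then 1 else 0))
      + ∑ i ∈ Finset.range (min n (j + 1 - m)), c i = ∑ i ∈ Finset.range (min n (j + 1)), c i := by
  induction n with
  | zero => simp
  | succ n ih =>
    rw [Finset.sum_range_succ]
    by_cases h1 : n < j + 1 - m
    · have e1 : min (n+1) (j+1-m) = n + 1 := by omega
      have e2 : min n (j+1-m) = n := by omega
      have e3 : min (n+1) (j+1) = n + 1 := by omega
      have e4 : min n (j+1) = n := by omega
      rw [e2, e4] at ih
      rw [e1, e3, Finset.sum_range_succ, if_neg (by omega)]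
      omega
    · have e1 : min (n+1) (j+1-m) = min n (j+1-m) := by omega
      rw [e1]
      by_cases h2 : n ≤ j
      · have e3 : min (n+1) (j+1) = n + 1 := by omega
        have e4 : min n (j+1) = n := by omega
        rw [e4] at ih
        rw [e3, Finset.sum_range_succ, if_pos (by omega)]
        omega
      · have e3 : min (n+1) (j+1) = min n (j+1) := by omega
        rw [e3, if_neg (by omega)]
        omega

lemma tele (M : ℕ → ℕ) (hM : Monotone M) (h0 : M 0 = 0) (x : ℕ) :
    ∑ i ∈ Finset.range x, (M (i+1) - M i) = M x := by
  induction x with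
  | zero => simp [h0]
  | succ x ih =>
    rw [Finset.sum_range_succ, ih]
    have := hM (Nat.le_succ x)
    simp only [Nat.succ_eq_add_one] at this
    omega

lemma psum_mono (a : ℕ → ℕ) : Monotone (fun x => ∑ i ∈ Finset.range x, a i) := by
  intro x y h
  exact Finset.sum_le_sum_of_subset (Finset.range_mono h)

lemma comb (m n s : ℕ) (hm : 2 ≤ m) (hnm : m ≤ n) (u a b : ℕ → ℕ)
    (hb : ∑ i ∈ Finset.range n, b i = s) (ha : ∑ i ∈ Finset.range n, a i = s + 1)
    (hbu : ∀ j < n + m, ∑ i ∈ Finset.range n, b i * (if i ≤ j ∧ j < i + m then 1 else 0) ≤ u j)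
    (hau : ∀ j < n, ∑ i ∈ Finset.range n, a i * (if i ≤ j ∧ j < i + m then 1 else 0) ≤ u j) :
    (∃ c : ℕ → ℕ, ∑ i ∈ Finset.range (n - m), c i = s + 1 ∧ ∀ j < n + m,
      ∑ i ∈ Finset.range (n - m), c i * (if i ≤ j ∧ j < i + m then 1 else 0) ≤ u j) ∨
    (∃ c : ℕ → ℕ, ∑ i ∈ Finset.range n, c i = s ∧ ∀ j < n + m,
      ∑ i ∈ Finset.range n, c i * (if i ≤ j ∧ j < i + m then 1 else 0)
        + (if j = n - 1 then 1 else 0) ≤ u j) := by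
  obtain ⟨SA, hSA⟩ : ∃ SA : ℕ → ℕ, SA = fun x => ∑ i ∈ Finset.range x, a i := ⟨_, rfl⟩
  obtain ⟨SB, hSB⟩ : ∃ SB : ℕ → ℕ, SB = fun x => ∑ i ∈ Finset.range x, b i := ⟨_, rfl⟩
  have mA : Monotone SA := hSA ▸ psum_mono a
  have mB : Monotone SB := hSB ▸ psum_mono b
  have A0 : SA 0 = 0 := by simp [hSA]
  have B0 : SB 0 = 0 := by simp [hSB]
  have An : SA n = s + 1 := by simp [hSA, ha]
  have Bn : SB n = s := by simp [hSB, hb]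
  have cA : ∀ j < n, SA (min n (j+1)) ≤ SA (min n (j+1-m)) + u j := by
    intro j hj
    have h1 := hau j hj
    have h2 := cov_eq m a j n
    simp only [hSA]; omega
  have cB : ∀ j < n + m, SB (min n (j+1)) ≤ SB (min n (j+1-m)) + u j := by
    intro j hj
    have h1 := hbu j hj
    have h2 := cov_eq m b j n
    simp only [hSB]; omega
  obtain ⟨M, hM⟩ : ∃ M : ℕ → ℕ, M = fun x => max (SA (min (n-m) x)) (SB (min n x)) := ⟨_, rfl⟩
  have mM : Monotone M := by
    rw [hM]
    intro x y h
    exact max_le_max (mA (min_le_min le_rfl h)) (mB (min_le_min le_rfl h))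
  have M0 : M 0 = 0 := by simp [hM, A0, B0]
  have cM : ∀ j < n + m, M (j+1) ≤ M (j+1-m) + u j := by
    intro j hj
    have h1 := cB j hj
    have h2 : SA (min (n-m) (j+1)) ≤ SA (min (n-m) (j+1-m)) + u j := by
      by_cases h : j < n
      · have h3 := cA j h
        have h4 : SA (min (n-m) (j+1)) ≤ SA (min n (j+1)) := mA (by omega)
        have h5 : min n (j+1-m) = min (n-m) (j+1-m) := by omega
        rw [h5] at h3
        omega
      · have h5 : min (n-m) (j+1) = min (n-m) (j+1-m) := by omega
        rw [h5]; omega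
    simp only [hM]; omega
  have Mn : s ≤ M n := by simp only [hM, min_self, Bn]; omega
  have Mnm : s + 1 ≤ M (n-m) + u (n-1) := by
    have h1 := cA (n-1) (by omega)
    have e1 : min n (n-1+1) = n := by omega
    have e2 : min n (n-1+1-m) = n-m := by omega
    rw [e1, e2, An] at h1
    simp only [hM, min_self]; omega
  have key : ∀ T N, (∑ i ∈ Finset.range N, (min T (M (i+1)) - min T (M i)) = min T (M N)) ∧
      ∀ j, (∑ i ∈ Finset.range N, (min T (M (i+1)) - min T (M i)) *
        (if i ≤ j ∧ j < i + m then 1 else 0)) + min T (M (min N (j+1-m)))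
        = min T (M (min N (j+1))) := by
    intro T N
    have mT : Monotone (fun x => min T (M x)) := fun x y h => min_le_min le_rfl (mM h)
    have t := tele (fun x => min T (M x)) mT (by simp [M0])
    refine ⟨t N, fun j => ?_⟩
    have := cov_eq m (fun i => min T (M (i+1)) - min T (M i)) j N
    rw [t, t] at this
    exact this
  by_cases hc : s + 1 ≤ M (n-m)
  · left
    refine ⟨fun i => min (s+1) (M (i+1)) - min (s+1) (M i), ?_, ?_⟩
    · rw [(key (s+1) (n-m)).1]; omega
    · intro j hj
      have h1 := (key (s+1) (n-m)).2 j
      have h2 := cM j hj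
      have h3 : M (min (n-m) (j+1)) ≤ M (j+1) := mM (by omega)
      by_cases h4 : j+1-m ≤ n-m
      · rw [min_eq_right h4] at h1
        dsimp only
        omega
      · have e1 : min (n-m) (j+1-m) = n-m := by omega
        rw [e1] at h1
        dsimp only
        omega
  · right
    refine ⟨fun i => min s (M (i+1)) - min s (M i), ?_, ?_⟩
    · rw [(key s n).1]; omega
    · intro j hj
      have h1 := (key s n).2 j
      have h2 := cM j hj
      have h3 : M (min n (j+1)) ≤ M (j+1) := mM (by omega)
      have e1 : min n (j+1-m) = j+1-m := by omega
      rw [e1] at h1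
      dsimp only
      split_ifs with h4
      · subst h4
        have e2 : n - 1 + 1 - m = n - m := by omega
        rw [e2] at h1
        omega
      · omega

noncomputable def ee (m N i : ℕ) : Fin N →₀ ℕ :=
  Finsupp.equivFunOnFinite.symm fun j => if i ≤ j.val ∧ j.val < i + m then 1 else 0

lemma ee_apply (m N i : ℕ) (j : Fin N) :
    ee m N i j = if i ≤ j.val ∧ j.val < i + m then 1 else 0 := rfl

lemma prod_eq (k : Type*) [Field k] (m N i : ℕ) (g : Fin m → Fin N)
    (hg : ∀ j, (g j).val = i + j.val) :
    (∏ j : Fin m, X (g j) : MvPolynomial (Fin N) k) = monomial (ee m N i) 1 := by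
  have : ee m N i = ∑ j : Fin m, Finsupp.single (g j) 1 := by
    ext x
    rw [ee_apply, Finsupp.finsetSum_apply]
    simp only [Finsupp.single_apply, Fin.ext_iff, hg]
    split_ifs with h
    · rw [Finset.sum_eq_single (⟨x.val - i, by omega⟩ : Fin m)]
      · rw [if_pos]; simp; omega
      · intro b _ hb
        rw [if_neg]
        intro h'
        apply hb
        ext
        simp; omega
      · simp
    · symm
      apply Finset.sum_eq_zero
      intro b _
      rw [if_neg]
      have := b.isLt
      omega
  rw [this, monomial_sum_one]
  rfl

lemma pow_le (k : Type*) [Field k] {σ : Type*} (e : ℕ → σ →₀ ℕ) (N s : ℕ) :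
    (Ideal.span ((fun i => (monomial (e i) (1:k))) '' Set.Iio N)) ^ s ≤
      Ideal.span ((fun v => monomial v (1:k)) ''
        {v | ∃ c : ℕ → ℕ, ∑ i ∈ Finset.range N, c i = s ∧
          v = ∑ i ∈ Finset.range N, c i • e i}) := by
  induction s with
  | zero =>
    rw [pow_zero, Ideal.one_eq_top, top_le_iff, Ideal.eq_top_iff_one]
    apply Ideal.subset_span
    exact ⟨0, ⟨fun _ => 0, by simp, by simp⟩, rfl⟩
  | succ s ih =>
    rw [pow_succ]
    refine (Ideal.mul_mono_left ih).trans ?_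
    rw [Ideal.span_mul_span', Ideal.span_le]
    rintro _ ⟨_, ⟨_, ⟨c, hc, rfl⟩, rfl⟩, _, ⟨i, hi, rfl⟩, rfl⟩
    apply Ideal.subset_span
    have hi' : i ∈ Finset.range N := Finset.mem_range.2 hi
    refine ⟨_, ⟨fun j => c j + if j = i then 1 else 0, ?_, rfl⟩, ?_⟩
    · rw [Finset.sum_add_distrib, hc, Finset.sum_ite_eq', if_pos hi']
    · simp only [add_smul, Finset.sum_add_distrib, ite_smul, one_smul, zero_smul,
        Finset.sum_ite_eq', if_pos hi', monomial_mul, mul_one]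

lemma mono_mem (k : Type*) [Field k] {σ : Type*} (e : ℕ → σ →₀ ℕ) (N s : ℕ) (c : ℕ → ℕ)
    (hc : ∑ i ∈ Finset.range N, c i = s) :
    monomial (∑ i ∈ Finset.range N, c i • e i) (1:k) ∈
      (Ideal.span ((fun i => (monomial (e i) (1:k))) '' Set.Iio N)) ^ s := by
  rw [← hc, ← Finset.prod_pow_eq_pow_sum, monomial_sum_one]
  apply Ideal.prod_mem_prod
  intro i hi
  have : monomial (c i • e i) (1:k) = (monomial (e i) 1) ^ (c i) := by
    rw [monomial_pow, one_pow]
  rw [this]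
  refine Ideal.pow_mem_pow (Ideal.subset_span ?_) _
  exact ⟨i, Finset.mem_range.1 hi, rfl⟩


/-- Assume `n ≥ m` and let `t ≥ 1`, `s ≥ 0` be integers. Then
`J^s ∩ (J^{s+1} I_{n,m}^{t-1} : f_{n+1}^t) ⊆ J^s (A + (x_n))`, where
`I_{n,m} = (f_1, …, f_{n+1})`, `J = (f_1, …, f_n)`, `A = (f_1, …, f_{n-m})`
and `f_i = x_i ⋯ x_{i+m-1}`. Generators are 0-indexed: `f i` for `0 ≤ i ≤ n`
is the paper's `f_{i+1}`, so `f n` is the paper's `f_{n+1}`; `x_n` is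
`X ⟨n-1, _⟩`. -/
theorem stmt_6 (k : Type*) [Field k] (m n : ℕ) (hm : 2 ≤ m) (hnm : m ≤ n)
    (f : ℕ → MvPolynomial (Fin (n + m)) k)
    (hf : ∀ i, ∀ hi : i ≤ n, f i = ∏ j : Fin m,
      X (⟨i + j.val, by have := j.isLt; omega⟩ : Fin (n + m)))
    (I J A : Ideal (MvPolynomial (Fin (n + m)) k))
    (hI : I = Ideal.span (f '' Set.Iic n))
    (hJ : J = Ideal.span (f '' Set.Iio n))
    (hA : A = Ideal.span (f '' Set.Iio (n - m)))
    (xn : MvPolynomial (Fin (n + m)) k)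
    (hxn : xn = X (⟨n - 1, by omega⟩ : Fin (n + m)))
    (t s : ℕ) (ht : 1 ≤ t) :
    J ^ s ⊓ Submodule.colon (J ^ (s + 1) * I ^ (t - 1)) (Ideal.span {f n ^ t}) ≤
      J ^ s * (A + Ideal.span {xn}) := by
  set e : ℕ → Fin (n+m) →₀ ℕ := ee m (n+m) with he
  have hfe : ∀ i ≤ n, f i = monomial (e i) 1 := fun i hi => by
    rw [hf i hi]
    exact prod_eq k m (n+m) i _ fun _ => rfl
  have hJ' : J = Ideal.span ((fun i => (monomial (e i) (1:k))) '' Set.Iio n) := by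
    rw [hJ]; congr 1
    exact Set.image_congr fun i hi => hfe i (le_of_lt hi)
  have hA' : A = Ideal.span ((fun i => (monomial (e i) (1:k))) '' Set.Iio (n-m)) := by
    rw [hA]; congr 1
    exact Set.image_congr fun i hi => hfe i (by have : i < n - m := hi; omega)
  have hAJ : A ≤ J := by
    rw [hA, hJ]
    apply Ideal.span_mono
    apply Set.image_mono
    intro i hi
    have : i < n - m := hi
    exact (by omega : i < n)
  rintro g ⟨hg1, hg2⟩
  have hg3 : g * f n ^ t ∈ J ^ (s+1) := by
    have h := Submodule.mem_colon.1 hg2 (f n ^ t) (Ideal.subset_span rfl)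
    exact Ideal.mul_le_left h
  have hg1' := pow_le k e n s (hJ' ▸ hg1)
  have hg3' := pow_le k e n (s+1) (hJ' ▸ hg3)
  rw [mem_ideal_span_monomial_image] at hg1' hg3'
  rw [hfe n le_rfl, monomial_pow, one_pow] at hg3'
  rw [g.as_sum]
  apply Ideal.sum_mem
  intro u hu
  obtain ⟨_, ⟨b, hb, rfl⟩, hbu⟩ := hg1' u hu
  obtain ⟨_, ⟨a, ha, rfl⟩, hau⟩ := hg3' (u + t • e n) (by
    rw [mem_support_iff, coeff_mul_monomial, mul_one]
    exact mem_support_iff.1 hu)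
  have hev : ∀ (N : ℕ) (c : ℕ → ℕ) (j : Fin (n+m)), (∑ i ∈ Finset.range N, c i • e i) j =
      ∑ i ∈ Finset.range N, c i * (if i ≤ j.val ∧ j.val < i + m then 1 else 0) := by
    intro N c j
    rw [Finsupp.finsetSum_apply]
    rfl
  have hmul : ∀ v : Fin (n+m) →₀ ℕ, v ≤ u →
      monomial u (coeff u g) = monomial (u - v) (coeff u g) * monomial v (1:k) := by
    intro v hv
    rw [monomial_mul, mul_one, tsub_add_cancel_of_le hv]
  rcases comb m n s hm hnm (fun j => if h : j < n + m then u ⟨j, h⟩ else 0) a b hb ha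
    (by
      intro j hj
      have := hbu ⟨j, hj⟩
      rw [hev] at this
      simpa only [dif_pos hj] using this)
    (by
      intro j hj
      have hj' : j < n + m := by omega
      have := hau ⟨j, hj'⟩
      rw [hev, Finsupp.add_apply, Finsupp.smul_apply, he, ee_apply, if_neg (by simp; omega),
        smul_zero, add_zero] at this
      simpa only [dif_pos hj'] using this) with ⟨c, hc, hcu⟩ | ⟨c, hc, hcu⟩
  · have hle : ∑ i ∈ Finset.range (n-m), c i • e i ≤ u := by
      intro j
      have := hcu j j.isLt
      rw [hev]
      simpa only [dif_pos j.isLt] using this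
    rw [hmul _ hle]
    apply Ideal.mul_mem_left
    have h := mono_mem k e (n-m) (s+1) c hc
    rw [← hA', pow_succ] at h
    exact Ideal.mul_mono (Ideal.pow_right_mono hAJ s) le_sup_left h
  · have hle : ∑ i ∈ Finset.range n, c i • e i +
        Finsupp.single (⟨n - 1, by omega⟩ : Fin (n + m)) 1 ≤ u := by
      intro j
      have := hcu j j.isLt
      rw [Finsupp.add_apply, hev, Finsupp.single_apply]
      simp only [dif_pos j.isLt] at this
      simp only [Fin.ext_iff, eq_comm (a := n - 1)]
      exact this
    rw [hmul _ hle]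
    apply Ideal.mul_mem_left
    have h := mono_mem k e n s c hc
    rw [← hJ'] at h
    rw [← mul_one (1:k), ← monomial_mul]
    apply Ideal.mul_mem_mul h
    apply Ideal.mem_sup_right
    rw [hxn]
    exact Ideal.subset_span rfl
end

section
/- Let t ≥ 1 and s ≥ 0 be integers. Then J^{s+1} I_{n,m}^{t-1} : f_{n+1}^t = Σ_{j=0}^{t-1} (J^{s+1+j} : f_{n+1}^{j+1}) (a sum of ideals). -/
open MvPolynomial


def MonI {σ k : Type*} [Field k] (K : Ideal (MvPolynomial σ k)) : Prop :=
  ∃ S : Set (σ →₀ ℕ), K = Ideal.span ((fun d => monomial d (1 : k)) '' S)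

lemma MonI.mul {σ k : Type*} [Field k] {K L : Ideal (MvPolynomial σ k)}
    (hK : MonI K) (hL : MonI L) : MonI (K * L) := by
  obtain ⟨S, rfl⟩ := hK
  obtain ⟨T, rfl⟩ := hL
  refine ⟨Set.image2 (· + ·) S T, ?_⟩
  rw [Ideal.span_mul_span']
  congr 1
  ext x
  simp only [Set.mem_mul, Set.mem_image, Set.mem_image2]
  constructor
  · rintro ⟨_, ⟨a, ha, rfl⟩, _, ⟨b, hb, rfl⟩, rfl⟩
    exact ⟨_, ⟨a, ha, b, hb, rfl⟩, by simp [monomial_mul]⟩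
  · rintro ⟨_, ⟨a, ha, b, hb, rfl⟩, rfl⟩
    exact ⟨_, ⟨a, ha, rfl⟩, _, ⟨b, hb, rfl⟩, by simp [monomial_mul]⟩

lemma MonI.pow {σ k : Type*} [Field k] {K : Ideal (MvPolynomial σ k)}
    (hK : MonI K) (r : ℕ) : MonI (K ^ r) := by
  induction r with
  | zero =>
    refine ⟨{0}, ?_⟩
    simp only [pow_zero, Set.image_singleton, Ideal.one_eq_top]
    symm
    rw [Ideal.span_singleton_eq_top]
    exact isUnit_one
  | succ r ih => rw [pow_succ]; exact ih.mul hK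

lemma MonI.sum_mem {σ k : Type*} [Field k] (t : ℕ) (K : ℕ → Ideal (MvPolynomial σ k))
    (hK : ∀ i, MonI (K i)) (p : MvPolynomial σ k)
    (hp : p ∈ ∑ i ∈ Finset.range t, K i) (d : σ →₀ ℕ) (hd : d ∈ p.support) :
    ∃ i < t, monomial d (1 : k) ∈ K i := by
  choose S hS using hK
  have : ∑ i ∈ Finset.range t, K i ≤
      Ideal.span ((fun d => monomial d (1 : k)) '' (⋃ i ∈ Finset.range t, S i)) := by
    rw [Ideal.sum_eq_sup]
    refine Finset.sup_le fun i hi => ?_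
    rw [hS i]
    exact Ideal.span_mono (Set.image_mono (Set.subset_biUnion_of_mem (u := S) hi))
  have h := mem_ideal_span_monomial_image.1 (this hp) d hd
  obtain ⟨e, he, hle⟩ := h
  simp only [Set.mem_iUnion, Finset.mem_range] at he
  obtain ⟨i, hi, he⟩ := he
  refine ⟨i, hi, ?_⟩
  rw [hS i, mem_ideal_span_monomial_image]
  intro x hx
  have := support_monomial_subset hx
  rw [Finset.mem_singleton] at this
  exact ⟨e, he, this ▸ hle⟩

lemma mem_colon_sg {R : Type*} [CommRing R] (K : Ideal R) (g u : R) :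
    u ∈ Submodule.colon K (Ideal.span {g} : Ideal R) ↔ u * g ∈ K := by
  rw [Submodule.mem_colon]
  constructor
  · intro h
    exact h g (Ideal.mem_span_singleton_self g)
  · intro h p hp
    obtain ⟨c, rfl⟩ := Ideal.mem_span_singleton'.1 hp
    have : u • (c * g) = c * (u * g) := by simp only [smul_eq_mul]; ring
    rw [this]
    exact K.mul_mem_left _ h

/-- Let `t ≥ 1` and `s ≥ 0` be integers. Then
`J^{s+1} I_{n,m}^{t-1} : f_{n+1}^t = Σ_{j=0}^{t-1} (J^{s+1+j} : f_{n+1}^{j+1})`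
(a sum of ideals), where `I_{n,m} = (f_1, …, f_{n+1})`, `J = (f_1, …, f_n)`
and `f_i = x_i ⋯ x_{i+m-1}`. Generators are 0-indexed: `f i` for `0 ≤ i ≤ n`
is the paper's `f_{i+1}`, so `f n` is the paper's `f_{n+1}`. -/
theorem stmt_7 (k : Type*) [Field k] (m n : ℕ) (hm : 2 ≤ m)
    (f : ℕ → MvPolynomial (Fin (n + m)) k)
    (hf : ∀ i, ∀ hi : i ≤ n, f i = ∏ j : Fin m,
      X (⟨i + j.val, by have := j.isLt; omega⟩ : Fin (n + m)))
    (I J : Ideal (MvPolynomial (Fin (n + m)) k))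
    (hI : I = Ideal.span (f '' Set.Iic n))
    (hJ : J = Ideal.span (f '' Set.Iio n))
    (t s : ℕ) (ht : 1 ≤ t) :
    Submodule.colon (J ^ (s + 1) * I ^ (t - 1)) (Ideal.span {f n ^ t}) =
      ∑ j ∈ Finset.range t,
        Submodule.colon (J ^ (s + 1 + j)) (Ideal.span {f n ^ (j + 1)}) := by
  classical
  obtain ⟨E, hE⟩ : ∃ E : ℕ → (Fin (n + m) →₀ ℕ), ∀ i ≤ n, f i = monomial (E i) 1 := by
    have : ∀ i, ∃ e : Fin (n + m) →₀ ℕ, i ≤ n → f i = monomial e 1 := by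
      intro i
      by_cases hi : i ≤ n
      · refine ⟨∑ j : Fin m, Finsupp.single
          (⟨i + j.val, by have := j.isLt; omega⟩ : Fin (n + m)) 1, fun _ => ?_⟩
        rw [hf i hi, monomial_sum_one]
        rfl
      · exact ⟨0, fun h => absurd h hi⟩
    choose E hE using this
    exact ⟨E, hE⟩
  have hJm : MonI J := by
    refine ⟨E '' Set.Iio n, ?_⟩
    rw [hJ, Set.image_image]
    congr 1
    exact Set.image_congr fun i hi => hE i (le_of_lt hi)
  have hgm : MonI (Ideal.span {f n}) := ⟨{E n}, by rw [Set.image_singleton, hE n le_rfl]⟩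
  have hIJ : I = J + Ideal.span {f n} := by
    rw [hI, hJ, Submodule.add_eq_sup, ← Ideal.span_union, ← Set.image_singleton, ← Set.image_union]
    congr 2
    ext x; simp [le_iff_lt_or_eq]
  have hg0 : f n ≠ 0 := by rw [hE n le_rfl]; simp
  have hgI : f n ∈ I := by rw [hI]; exact Ideal.subset_span ⟨n, Set.mem_Iic.2 le_rfl, rfl⟩
  have hJI : J ≤ I := by rw [hIJ]; exact le_sup_left
  obtain ⟨r, rfl⟩ : ∃ r, t = r + 1 := ⟨t - 1, by omega⟩
  simp only [Nat.add_sub_cancel]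
  apply le_antisymm
  · intro p hp
    rw [mem_colon_sg] at hp
    have hle : J ^ (s + 1) * I ^ r ≤
        ∑ i ∈ Finset.range (r + 1), J ^ (s + 1 + i) * (Ideal.span {f n}) ^ (r - i) := by
      rw [hIJ, add_pow, Finset.mul_sum]
      refine Finset.sum_le_sum fun i _ => ?_
      rw [← mul_assoc, ← mul_assoc, ← pow_add]
      exact Ideal.mul_le_left
    rw [p.as_sum]
    refine Ideal.sum_mem _ fun d hd => ?_
    have hd' : d + (r + 1) • E n ∈ (p * f n ^ (r + 1)).support := by
      rw [hE n le_rfl, monomial_pow, one_pow, mem_support_iff, coeff_mul_monomial, mul_one]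
      exact mem_support_iff.1 hd
    obtain ⟨i, hi, hmem⟩ := MonI.sum_mem (r + 1) _
      (fun i => (hJm.pow (s + 1 + i)).mul (hgm.pow (r - i))) _ (hle hp) _ hd'
    have h1 : monomial d (1 : k) * f n ^ (i + 1) ∈ J ^ (s + 1 + i) := by
      rw [Ideal.span_singleton_pow, mul_comm (J ^ _), Ideal.mem_span_singleton_mul] at hmem
      obtain ⟨z, hz, hz'⟩ := hmem
      have : z = monomial d (1 : k) * f n ^ (i + 1) := by
        apply mul_left_cancel₀ (pow_ne_zero (r - i) hg0)
        rw [hz']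
        have e : r + 1 = (r - i) + (i + 1) := by omega
        have : monomial (d + (r + 1) • E n) (1 : k) = monomial d 1 * f n ^ (r + 1) := by
          rw [hE n le_rfl, monomial_pow, one_pow, monomial_mul, one_mul]
        rw [this, e, pow_add]; ring
      exact this ▸ hz
    have h2 : monomial d (coeff d p) = C (coeff d p) * monomial d (1 : k) := by
      rw [C_mul_monomial, mul_one]
    rw [h2]
    refine Ideal.mul_mem_left _ _ ?_
    rw [Ideal.sum_eq_sup]
    exact (Finset.le_sup (f := fun j => Submodule.colon (J ^ (s + 1 + j))
      (Ideal.span {f n ^ (j + 1)} : Ideal (MvPolynomial (Fin (n + m)) k)))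
      (Finset.mem_range.2 hi)) ((mem_colon_sg _ _ _).2 h1)
  · rw [Ideal.sum_eq_sup]
    refine Finset.sup_le fun j hj u hu => ?_
    rw [Finset.mem_range] at hj
    rw [mem_colon_sg] at hu ⊢
    have e : r + 1 = (j + 1) + (r - j) := by omega
    have e2 : r = j + (r - j) := by omega
    have h3 := Ideal.mul_mem_mul hu (Ideal.pow_mem_pow hgI (r - j))
    rw [e, pow_add (f n), ← mul_assoc]
    refine (?_ : _ ≤ J ^ (s + 1) * I ^ r) h3
    rw [pow_add, mul_assoc]
    refine Ideal.mul_mono_right ?_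
    conv_rhs => rw [e2, pow_add]
    exact Ideal.mul_mono_left (Ideal.pow_right_mono hJI j)
end

section
/- For all integers m ≥ 2, t ≥ 1, n ∈ ℤ, i ≥ 0 and ℓ ≥ 0, the following identity holds: d(n,t+1,i,ℓ) = d(n,t,i,ℓ) + d(n-1,t+1,i,ℓ) + d(n-1,t,i-1,ℓ) + d(n-m-1,t+1,i-1,ℓ-1) + d(n-m-1,t+1,i-2,ℓ-1). -/
/-- The binomial coefficient `C(a,b)` for integers `a, b`, with the convention
that `C(a,b) = 0` if `a < 0`, `b < 0`, or `a < b`. -/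
def intChoose (a b : ℤ) : ℤ :=
  if a < 0 ∨ b < 0 ∨ a < b then 0 else (Nat.choose a.toNat b.toNat : ℤ)

/-- `d(n,t,i,ℓ) = C(t+ℓ-1, ℓ) · C(n-ℓm, i-ℓ) · C(n+t-ℓm-i+ℓ, t-i+2ℓ)`. -/
def dFun (m n t i l : ℤ) : ℤ :=
  intChoose (t + l - 1) l * intChoose (n - l * m) (i - l) *
    intChoose (n + t - l * m - i + l) (t - i + 2 * l)

theorem ic_zero {a b : ℤ} (h : a < 0 ∨ b < 0 ∨ a < b) : intChoose a b = 0 := by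
  simp only [intChoose, if_pos h]

theorem ic_nat (a b : ℕ) : intChoose a b = (Nat.choose a b : ℤ) := by
  unfold intChoose
  split_ifs with h
  · rw [Nat.choose_eq_zero_of_lt (by omega)]; rfl
  · simp

theorem ic_pascal (a b : ℤ) (h : ¬ (a = -1 ∧ b = 0)) :
    intChoose (a + 1) b = intChoose a b + intChoose a (b - 1) := by
  rcases lt_or_ge b 0 with hb | hb
  · rw [ic_zero (by omega), ic_zero (by omega), ic_zero (by omega)]; rfl
  rcases lt_or_ge a 0 with ha | ha
  · rw [ic_zero (by omega), ic_zero (by omega), ic_zero (by omega)]; rfl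
  lift a to ℕ using ha
  lift b to ℕ using hb
  rcases b with _ | b
  · rw [ic_zero (b := ((0 : ℕ) : ℤ) - 1) (by omega)]
    have := ic_nat (a + 1) 0
    push_cast at this
    have h2 := ic_nat a 0
    push_cast at h2 ⊢
    simp [this, h2]
  · have h1 := ic_nat (a + 1) (b + 1)
    have h2 := ic_nat a (b + 1)
    have h3 := ic_nat a b
    have e : ((b + 1 : ℕ) : ℤ) - 1 = b := by push_cast; ring
    rw [e, h2, h3]
    push_cast at h1 ⊢
    rw [h1, Nat.choose_succ_succ]
    push_cast
    ring

theorem ic_self (a : ℤ) (h : 0 ≤ a) : intChoose a a = 1 := by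
  lift a to ℕ using h
  rw [ic_nat]; simp

theorem ic_zero_right (a : ℤ) (h : 0 ≤ a) : intChoose a 0 = 1 := by
  lift a to ℕ using h
  have := ic_nat a 0
  simpa using this

theorem core (t l N k : ℤ) (ht : 1 ≤ t) (hl : 0 ≤ l) :
    intChoose (t + l) l * intChoose N k * intChoose (N - k + t + 1) (t + l - k + 1) =
      intChoose (t + l - 1) l * intChoose N k * intChoose (N - k + t) (t + l - k)
      + intChoose (t + l) l * intChoose (N - 1) k * intChoose (N - k + t) (t + l - k + 1)
      + intChoose (t + l - 1) l * intChoose (N - 1) (k - 1)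
          * intChoose (N - k + t) (t + l - k + 1)
      + intChoose (t + l - 1) (l - 1) * intChoose (N - 1) k * intChoose (N - k + t) (t + l - k)
      + intChoose (t + l - 1) (l - 1) * intChoose (N - 1) (k - 1)
          * intChoose (N - k + t + 1) (t + l - k + 1) := by
  rcases lt_or_ge N k with hk | hk
  · rw [ic_zero (a := N) (b := k) (by omega), ic_zero (a := N - 1) (b := k) (by omega),
      ic_zero (a := N - 1) (b := k - 1) (by omega)]
    ring
  by_cases h0 : N = 0 ∧ k = 0
  · obtain ⟨rfl, rfl⟩ := h0
    rw [ic_zero (a := 0 - 1) (b := 0) (by omega), ic_zero (a := 0 - 1) (b := 0 - 1) (by omega)]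
    rcases hl.eq_or_lt with rfl | hl
    · simp only [add_zero, sub_zero, zero_add, mul_zero, zero_mul]
      rw [ic_self t (by omega), ic_self (t + 1) (by omega), ic_zero_right t (by omega),
        ic_zero_right (t - 1) (by omega)]
    · rw [ic_zero (a := 0 - 0 + t + 1) (by omega), ic_zero (a := 0 - 0 + t) (by omega)]
      ring
  have p1 := ic_pascal (t + l - 1) l (by omega)
  have p2 := ic_pascal (N - 1) k (by omega)
  have p3 := ic_pascal (N - k + t) (t + l - k + 1) (by omega)
  rw [sub_add_cancel] at p1 p2
  rw [add_sub_cancel_right] at p3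
  rw [p1, p2, p3]
  ring

/-- For all integers `m ≥ 2`, `t ≥ 1`, `n ∈ ℤ`, `i ≥ 0` and `ℓ ≥ 0`:
`d(n,t+1,i,ℓ) = d(n,t,i,ℓ) + d(n-1,t+1,i,ℓ) + d(n-1,t,i-1,ℓ)
  + d(n-m-1,t+1,i-1,ℓ-1) + d(n-m-1,t+1,i-2,ℓ-1)`. -/
theorem stmt_8 (m t n i l : ℤ) (hm : 2 ≤ m) (ht : 1 ≤ t) (hi : 0 ≤ i)
    (hl : 0 ≤ l) :
    dFun m n (t + 1) i l =
      dFun m n t i l + dFun m (n - 1) (t + 1) i l + dFun m (n - 1) t (i - 1) l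
        + dFun m (n - m - 1) (t + 1) (i - 1) (l - 1)
        + dFun m (n - m - 1) (t + 1) (i - 2) (l - 1) := by
  have h := core t l (n - l * m) (i - l) ht hl
  unfold dFun
  convert h using 1
  · congr 2 <;> ring_nf
  · ring_nf
end

section
/- For all integers m ≥ 2, n ≥ 0 and t ≥ 1: the maximum of min(t + 2ℓ, n - (m-1)ℓ) over all integers ℓ with 0 ≤ ℓ ≤ ⌊n/(m+1)⌋ equals min( n, t - 1 + ⌊(n-t+1)/(m+1)⌋ + ⌈(n-t+1)/(m+1)⌉ ). -/
theorem aux_13 (m n t q C : ℤ) (hm : 2 ≤ m) (hn : 0 ≤ n) (ht : 1 ≤ t)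
    (h1 : q * (m + 1) ≤ n - t + 1) (h2 : n - t + 1 < (q + 1) * (m + 1))
    (h3 : (C = q ∧ n - t + 1 = q * (m + 1)) ∨ (C = q + 1 ∧ q * (m + 1) < n - t + 1)) :
    IsGreatest
      {v : ℤ | ∃ l : ℤ, 0 ≤ l ∧ l * (m + 1) ≤ n ∧
        v = min (t + 2 * l) (n - (m - 1) * l)}
      (min n (t - 1 + q + C)) := by
  by_cases hnt : n < t
  · have hq : q ≤ 0 := by
      by_contra hc
      nlinarith
    have key : n ≤ t - 1 + q + C := by
      rcases h3 with ⟨rfl, h⟩ | ⟨rfl, h⟩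
      · nlinarith
      · have : q ≤ -1 := by
          by_contra hc
          have : q = 0 := by omega
          subst this
          omega
        nlinarith
    rw [min_eq_left key]
    constructor
    · exact ⟨0, le_refl _, by simpa using hn, by simp; omega⟩
    · rintro v ⟨l, hl, -, rfl⟩
      exact (min_le_right _ _).trans (by nlinarith)
  · have hq : 0 ≤ q := by
      by_contra hc
      nlinarith
    have key : t - 1 + q + C ≤ n := by
      rcases h3 with ⟨rfl, h⟩ | ⟨rfl, h⟩ <;> nlinarith
    rw [min_eq_right key]
    constructor
    · refine ⟨q, hq, by linarith, ?_⟩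
      rcases h3 with ⟨rfl, h⟩ | ⟨rfl, h⟩
      · rw [min_eq_right] <;> linarith
      · rw [min_eq_left] <;> linarith
    · rintro v ⟨l, hl, -, rfl⟩
      rcases h3 with ⟨rfl, h⟩ | ⟨rfl, h⟩
      · rcases lt_or_ge l C with hlq | hlq
        · exact (min_le_left _ _).trans (by linarith)
        · exact (min_le_right _ _).trans (by nlinarith)
      · rcases le_or_gt l q with hlq | hlq
        · exact (min_le_left _ _).trans (by linarith)
        · have h5 : q + 1 ≤ l := hlq
          exact (min_le_right _ _).trans (by nlinarith)


/-- For all integers `m ≥ 2`, `n ≥ 0` and `t ≥ 1`: the maximum of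
`min(t + 2ℓ, n - (m-1)ℓ)` over all integers `ℓ` with `0 ≤ ℓ ≤ ⌊n/(m+1)⌋`
equals `min(n, t - 1 + ⌊(n-t+1)/(m+1)⌋ + ⌈(n-t+1)/(m+1)⌉)`. -/
theorem stmt_13 (m n t : ℤ) (hm : 2 ≤ m) (hn : 0 ≤ n) (ht : 1 ≤ t) :
    IsGreatest
      {v : ℤ | ∃ l : ℤ, 0 ≤ l ∧ l ≤ ⌊(n : ℚ) / (m + 1)⌋ ∧
        v = min (t + 2 * l) (n - (m - 1) * l)}
      (min n (t - 1 + ⌊((n - t + 1 : ℤ) : ℚ) / (m + 1)⌋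
        + ⌈((n - t + 1 : ℤ) : ℚ) / (m + 1)⌉)) := by
  have hd : (0 : ℚ) < (m : ℚ) + 1 := by
    have : (2 : ℚ) ≤ m := by exact_mod_cast hm
    linarith
  have hfl : ∀ l : ℤ, l ≤ ⌊(n : ℚ) / (m + 1)⌋ ↔ l * (m + 1) ≤ n := by
    intro l
    rw [Int.le_floor, le_div_iff₀ hd]
    exact_mod_cast Iff.rfl
  simp only [hfl]
  generalize hN : n - t + 1 = N
  have a1 : ⌊(N : ℚ) / (m + 1)⌋ * (m + 1) ≤ N := by
    have := Int.floor_le ((N : ℚ) / (m + 1))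
    rw [le_div_iff₀ hd] at this
    exact_mod_cast this
  have a2 : N < (⌊(N : ℚ) / (m + 1)⌋ + 1) * (m + 1) := by
    have := Int.lt_floor_add_one ((N : ℚ) / (m + 1))
    rw [div_lt_iff₀ hd] at this
    exact_mod_cast this
  have a3 : N ≤ ⌈(N : ℚ) / (m + 1)⌉ * (m + 1) := by
    have := Int.le_ceil ((N : ℚ) / (m + 1))
    rw [div_le_iff₀ hd] at this
    exact_mod_cast this
  have a4 : (⌈(N : ℚ) / (m + 1)⌉ - 1) * (m + 1) < N := by
    have := Int.ceil_lt_add_one ((N : ℚ) / (m + 1))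
    rw [← sub_lt_iff_lt_add, lt_div_iff₀ hd] at this
    exact_mod_cast this
  generalize ⌊(N : ℚ) / (m + 1)⌋ = q at *
  generalize ⌈(N : ℚ) / (m + 1)⌉ = C at *
  subst hN
  refine aux_13 m n t q C hm hn ht a1 a2 ?_
  have b1 : q ≤ C := by
    by_contra hc
    nlinarith
  have b2 : C ≤ q + 1 := by
    by_contra hc
    nlinarith
  rcases eq_or_lt_of_le b1 with rfl | hlt
  · exact Or.inl ⟨rfl, le_antisymm a3 a1⟩
  · have : C = q + 1 := by omega
    subst this
    exact Or.inr ⟨rfl, by simpa using a4⟩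
end

section
/- For all integers m ≥ 2, n ≥ 0 and t ≥ 1: the maximum of tm + (m-1)ℓ over all integers ℓ ≥ 0 for which there exists an integer i ≥ 0 with n - ℓm ≥ ℓ, n - ℓm ≥ i - ℓ, i ≥ ℓ, and 2ℓ + t ≥ i, equals tm + (m-1)⌊n/(m+1)⌋. -/
/-- For all integers `m ≥ 2`, `n ≥ 0` and `t ≥ 1`: the maximum of
`tm + (m-1)ℓ` over all integers `ℓ ≥ 0` for which there exists an integer
`i ≥ 0` with `n - ℓm ≥ ℓ`, `n - ℓm ≥ i - ℓ`, `i ≥ ℓ`, and `2ℓ + t ≥ i`,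
equals `tm + (m-1)⌊n/(m+1)⌋`. -/
theorem stmt_14 (m n t : ℤ) (hm : 2 ≤ m) (hn : 0 ≤ n) (ht : 1 ≤ t) :
    IsGreatest
      {v : ℤ | ∃ l : ℤ, 0 ≤ l ∧
        (∃ i : ℤ, 0 ≤ i ∧ l ≤ n - l * m ∧ i - l ≤ n - l * m ∧ l ≤ i ∧
          i ≤ 2 * l + t) ∧
        v = t * m + (m - 1) * l}
      (t * m + (m - 1) * ⌊(n : ℚ) / (m + 1)⌋) := by
  have hmq : (0 : ℚ) < (m : ℚ) + 1 := by
    have : (2 : ℚ) ≤ (m : ℚ) := by exact_mod_cast hm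
    linarith
  have key : ∀ l : ℤ, l ≤ ⌊(n : ℚ) / (m + 1)⌋ ↔ l * (m + 1) ≤ n := by
    intro l
    rw [Int.le_floor, le_div_iff₀ hmq]
    exact_mod_cast Iff.rfl
  have h0 : 0 ≤ ⌊(n : ℚ) / (m + 1)⌋ := (key 0).2 (by linarith)
  have h1 := (key _).1 le_rfl
  refine ⟨⟨_, h0, ⟨_, h0, by linarith, by linarith, le_rfl, by linarith⟩, rfl⟩, ?_⟩
  rintro v ⟨l, hl, ⟨i, hi, h2, -, -, -⟩, rfl⟩
  have h3 := (key l).2 (by linarith)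
  have := mul_le_mul_of_nonneg_left h3 (show 0 ≤ m - 1 by linarith)
  linarith
end
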